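/- Let s < 0 be an integer and d ≥ 0. Then S_d(s) ≠ 0 if and only if U_d(−s) ≠ ∅. Moreover, if U_d(−s) ≠ ∅ and G is the greedy element of U_d(−s) (the lexicographically largest element), then wt(G) > wt(m) for every m ∈ U_d(−s) with m ≠ G, and the degree in t of the polynomial S_d(s) equals wt(G). -/

import Mathlib

open Polynomial

/-- The power sum `S_d(-k) = ∑_{a monic, deg a = d} a^k`, written as a sum over the
lower-order coefficients of the monic polynomial. -/
noncomputable def powerSum (Fq : Type) [Field Fq] [Fintype Fq] (d k : ℕ) : Polynomial Fq :=
  ∑ c : Fin d → Fq, (X ^ d + ∑ i : Fin d, C (c i) * X ^ (i : ℕ)) ^ k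

/-- `m` sums to `k` with no carrying of digits in base `p`. -/
def NoCarry (p : ℕ) {n : ℕ} (m : Fin n → ℕ) (k : ℕ) : Prop :=
  (∑ i, m i) = k ∧ ∀ j : ℕ, (∑ i, m i / p ^ j % p) = k / p ^ j % p

/-- The set `U_d(k)`. -/
def Uset (p q d k : ℕ) : Set (Fin (d + 1) → ℕ) :=
  {m | NoCarry p m k ∧ ∀ i : Fin (d + 1), 0 < (i : ℕ) → 0 < m i ∧ (q - 1) ∣ m i}

/-- The weight of an element of `U_d(k)`. -/
def wtU {d : ℕ} (m : Fin (d + 1) → ℕ) : ℕ :=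
  ∑ i : Fin (d + 1), (d - (i : ℕ)) * m i

/-- Strict lexicographic order on tuples. -/
def LexLT {n : ℕ} (x y : Fin n → ℕ) : Prop :=
  ∃ i, (∀ j, j < i → x j = y j) ∧ x i < y i

/-- Lexicographic order on tuples. -/
def LexLE {n : ℕ} (x y : Fin n → ℕ) : Prop := x = y ∨ LexLT x y

/-- `L_k := min_{0 ≤ i < f} l(k p^i)/(q-1)` where `l` is the base-`q` digit sum, `q = p^f`. -/
noncomputable def Lval (p f k : ℕ) (hf : 0 < f) : ℚ :=
  (Finset.range f).inf' ⟨0, Finset.mem_range.mpr hf⟩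
    (fun i => ((Nat.digits (p ^ f) (k * p ^ i)).sum : ℚ) / ((p : ℚ) ^ f - 1))

/-- The set `W_d(N)` of compositions. -/
def Wset (p q d N : ℕ) : Set (Fin d → ℕ) :=
  {Y | NoCarry p Y N ∧ ∀ i : Fin d, (i : ℕ) + 1 < d → 0 < Y i ∧ (q - 1) ∣ Y i}

/-- The weight of a composition. -/
def wtW {d : ℕ} (Y : Fin d → ℕ) : ℕ := ∑ i : Fin d, ((i : ℕ) + 1) * Y i

/-- `X` is the modest (lexicographically largest) composition in `W_d(N)`. -/
def Modest (p q : ℕ) {d : ℕ} (N : ℕ) (X : Fin d → ℕ) : Prop :=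
  X ∈ Wset p q d N ∧ ∀ Y ∈ Wset p q d N, LexLE Y X

/-- `X` is an optimal (minimum weight) composition in `W_d(N)`. -/
def Optimal (p q : ℕ) {d : ℕ} (N : ℕ) (X : Fin d → ℕ) : Prop :=
  X ∈ Wset p q d N ∧ ∀ Y ∈ Wset p q d N, wtW X ≤ wtW Y

/-- `Γ(n) : Fin f → ℕ`, summing the base-`p` digits of `n` in each residue class mod `f`. -/
def Gamma (p f n : ℕ) : Fin f → ℕ :=
  fun i => ∑ j ∈ Finset.range (Nat.log p n + 1), if j % f = (i : ℕ) then n / p ^ j % p else 0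

/-- The cyclic matrix `E`, as a map: `(E x)_i = p x_{i+1} - x_i`, indices mod `f`. -/
def Emap (p : ℕ) {R : Type} [Ring R] {f : ℕ} (x : Fin f → R) : Fin f → R :=
  fun i => (p : R) * x ⟨((i : ℕ) + 1) % f, Nat.mod_lt _ i.pos⟩ - x i

/-- `𝔍 = {Γ(n) : n > 0 is q-even}`, where `q = p ^ f`. -/
def Jfrak (p f : ℕ) : Set (Fin f → ℕ) :=
  {w | ∃ n : ℕ, 0 < n ∧ (p ^ f - 1) ∣ n ∧ Gamma p f n = w}

/-- `I_d`. -/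
def Iset (p f d : ℕ) : Set (Fin f → ℕ) :=
  {u | (∃ n : ℕ, 0 < n ∧ Gamma p f n = u) ∧
    ∃ v : Fin (d - 1) → Fin f → ℕ, (∀ j, v j ∈ Jfrak p f) ∧ (∑ j, v j) < u}

/-- `J_d`. -/
def Jset (p f d : ℕ) : Set (Fin f → ℕ) :=
  if d = 0 then ∅ else Jfrak p f ∩ (Iset p f d \ Iset p f (d + 1))

/-- A composition is `τ`-monotonic. -/
def TauMonotonic (p f : ℕ) {d : ℕ} (X : Fin d → ℕ) : Prop :=
  ∀ i j : Fin d, i < j → ∀ m n : ℕ, X i / p ^ m % p ≠ 0 → X j / p ^ n % p ≠ 0 →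
    m % f = n % f → n ≤ m

/-- `W_d^B(N)`: compositions in `W_d(N)` whose `Γ`-matrix is `B`. -/
def WBset (p f d N : ℕ) (B : Fin d → Fin f → ℕ) : Set (Fin d → ℕ) :=
  {Y | Y ∈ Wset p (p ^ f) d N ∧ ∀ j, Gamma p f (Y j) = B j}

/-- The multizeta value `ζ(-k_1, …, -k_r)` as a (finite) sum over strictly
decreasing tuples of degrees. -/
noncomputable def multizeta (Fq : Type) [Field Fq] [Fintype Fq] {r : ℕ} (k : Fin r → ℕ) :
    Polynomial Fq :=
  ∑ᶠ (dt : Fin r → ℕ) (_ : StrictAnti dt), ∏ i, powerSum Fq (dt i) (k i)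

namespace Sheats
open Finset

structure Sys (p f : ℕ) [NeZero f] where
  hp : 2 ≤ p
  a : ZMod f → ℤ → ℤ
  mono : ∀ i, Monotone (a i)
  cls : ∀ i n, ((a i n : ℤ) : ZMod f) = i
  step : ∀ i n, a i n + f ≤ a i (n + ((p:ℤ) - 1))
  pos : ∀ i n, 1 ≤ n → (i.val : ℤ) ≤ a i n
  neg : ∀ i n, n ≤ 0 → a i n < i.val

/-- the carry operator -/
def E (p : ℕ) {f : ℕ} (u : ZMod f → ℤ) (i : ZMod f) : ℤ := (p:ℤ) * u (i+1) - u i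

lemma E_sub (p : ℕ) {f : ℕ} (u v : ZMod f → ℤ) (i : ZMod f) :
    E p (u - v) i = E p u i - E p v i := by simp [E]; ring
lemma E_add (p : ℕ) {f : ℕ} (u v : ZMod f → ℤ) (i : ZMod f) :
    E p (u + v) i = E p u i + E p v i := by simp [E]; ring

/-- tree lemma -/
lemma tree {p f : ℕ} [NeZero f] (hp : 2 ≤ p) (u : ZMod f → ℤ) (hu : ∀ j, 0 ≤ u j) (i : ZMod f)
    (hi : 1 ≤ u i) (hE : E p u i ≤ 0) :
    ∃ v : ZMod f → ℤ, (∀ j, 0 ≤ v j) ∧ (∀ j, v j ≤ u j) ∧ v i = 1 ∧ E p v i = -1 ∧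
      ∀ j, j ≠ i → 0 ≤ E p v j ∧ E p v j ≤ max 0 (E p u j) := by
  classical
  let S : Finset (ZMod f → ℤ) := (Fintype.piFinset (fun j => Icc 0 (u j))).filter
    (fun v => 1 ≤ v i ∧ ∀ j, j ≠ i → E p v j ≤ max 0 (E p u j))
  have hS : S.Nonempty := ⟨u, by simp [S, hu, hi]⟩
  obtain ⟨v, hv, hmin⟩ := S.exists_min_image (fun v => ∑ j, v j) hS
  simp only [S, mem_filter, Fintype.mem_piFinset, mem_Icc] at hv
  obtain ⟨hv0, hvi, hvE⟩ := hv
  have hp' : (2:ℤ) ≤ p := by exact_mod_cast hp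
  -- lowering one coordinate
  have low : ∀ j, 1 ≤ v j → (j = i → 2 ≤ v i) → (j ≠ i → E p v j + 1 ≤ max 0 (E p u j)) → False := by
    intro j hj h1 h2
    have hmem : Function.update v j (v j - 1) ∈ S := by
      simp only [S, mem_filter, Fintype.mem_piFinset, mem_Icc]
      refine ⟨?_, ?_, ?_⟩
      · intro l
        by_cases hl : l = j
        · subst hl; simp; have := hv0 l; omega
        · simp [hl]; exact hv0 l
      · by_cases hl : i = j
        · subst hl; simp; have := h1 rfl; omega
        · simp [hl]; exact hvi
      · intro l hl
        have hb := hvE l hl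
        have h3 : Function.update v j (v j - 1) (l+1) ≤ v (l+1) := by
          by_cases h : l + 1 = j
          · subst h; simp
          · simp [h]
        by_cases hlj : l = j
        · subst hlj
          have := h2 hl
          have h4 : Function.update v l (v l - 1) l = v l - 1 := by simp
          unfold E at this ⊢
          rw [h4]
          nlinarith
        · have h4 : Function.update v j (v j - 1) l = v l := by simp [hlj]
          unfold E at hb ⊢
          rw [h4]
          nlinarith
    have := hmin _ hmem
    simp only [Finset.sum_update_of_mem (mem_univ j)] at this
    rw [← Finset.add_sum_erase univ v (mem_univ j), sdiff_singleton_eq_erase] at this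
    omega
  have hvi1 : v i = 1 := by
    by_contra h
    exact low i hvi (fun _ => by omega) (fun h => absurd rfl h)
  have hpos : ∀ j, j ≠ i → 1 ≤ v j → E p v j = max 0 (E p u j) := by
    intro j hj hv1
    by_contra h
    refine low j hv1 (fun h => absurd h hj) (fun _ => ?_)
    have := hvE j hj
    omega
  have hEj : ∀ j, j ≠ i → 0 ≤ E p v j ∧ E p v j ≤ max 0 (E p u j) := by
    intro j hj
    refine ⟨?_, hvE j hj⟩
    by_cases h : 1 ≤ v j
    · rw [hpos j hj h]; exact le_max_left _ _
    · have h0 : v j = 0 := by have := (hv0 j).1; omega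
      unfold E; rw [h0]
      have := (hv0 (j+1)).1
      nlinarith
  have hz : v (i+1) = 0 := by
    by_contra hne
    have h1 : 1 ≤ v (i+1) := by have := (hv0 (i+1)).1; omega
    have hall : ∀ t : ℕ, t + 1 ≤ f → 1 ≤ v (i + 1 + t) ∧
        u (i+1+t) - v (i+1+t) ≤ u (i+1) - v (i+1) := by
      intro t
      induction t with
      | zero => intro _; simpa using h1
      | succ t ih =>
        intro ht
        obtain ⟨ih1, ih2⟩ := ih (by omega)
        have hji : i + 1 + (t:ZMod f) ≠ i := by
          intro h
          have h2 : ((t+1 : ℕ) : ZMod f) = 0 := by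
            push_cast
            have : i + (1 + (t:ZMod f)) = i := by rw [← add_assoc]; exact h
            simpa [add_comm] using this
          rw [ZMod.natCast_eq_zero_iff] at h2
          have := Nat.le_of_dvd (by omega) h2
          omega
        have h2 := hpos _ hji ih1
        have h3 : i + 1 + ((t+1:ℕ):ZMod f) = i + 1 + (t:ZMod f) + 1 := by push_cast; ring
        rw [h3]
        have h4 := le_max_left 0 (E p u (i + 1 + (t:ZMod f)))
        have h5 := le_max_right 0 (E p u (i + 1 + (t:ZMod f)))
        rw [← h2] at h4 h5
        unfold E at h4 h5
        have h6 : 1 ≤ v (i + 1 + (t:ZMod f) + 1) := by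
          by_contra h
          have : v (i + 1 + (t:ZMod f) + 1) ≤ 0 := by omega
          nlinarith
        refine ⟨h6, ?_⟩
        have h7 := (hv0 (i + 1 + (t:ZMod f) + 1)).2
        nlinarith
    have hf : 0 < f := Nat.pos_of_ne_zero (NeZero.ne f)
    obtain ⟨_, h2⟩ := hall (f-1) (by omega)
    have h3 : i + 1 + ((f-1:ℕ):ZMod f) = i := by
      rw [Nat.cast_sub (by omega)]; simp
    rw [h3, hvi1] at h2
    unfold E at hE
    have h4 := (hv0 (i+1)).2
    nlinarith
  refine ⟨v, fun j => (hv0 j).1, fun j => (hv0 j).2, hvi1, ?_, hEj⟩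
  unfold E; rw [hz, hvi1]; simp

end Sheats
namespace Sheats
open Finset

lemma E_shift (p : ℕ) {f : ℕ} (u : ZMod f → ℤ) (s : ℤ) (i : ZMod f) :
    E p (u - fun _ => s) i = E p u i - s * ((p:ℤ) - 1) := by simp [E]; ring

section
variable {p f : ℕ} [NeZero f] (S : Sys p f)

noncomputable def Sys.e (i : ZMod f) (n : ℤ) : ℝ := (p:ℝ) ^ (S.a i n)

noncomputable def Sys.C (i : ZMod f) (n : ℤ) : ℝ :=
  ∑ m ∈ Ioc 0 n, S.e i m - ∑ m ∈ Ioc n 0, S.e i m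

noncomputable def Sys.F (x : ZMod f → ℤ) : ℝ := ∑ i, S.C i (E p x i)

lemma Sys.one_lt {p f : ℕ} [NeZero f] (S : Sys p f) : (1:ℝ) < p := by have := S.hp; exact_mod_cast (by omega : 1 < p)

lemma Sys.e_pos (i : ZMod f) (n : ℤ) : 0 < S.e i n := by
  have := S.one_lt
  unfold Sys.e; positivity

lemma Sys.e_mono (i : ZMod f) : Monotone (S.e i) := by
  intro m n h
  exact zpow_le_zpow_right₀ S.one_lt.le (S.mono i h)

lemma Sys.e_le {i j : ZMod f} {m n : ℤ} (h : S.a i m ≤ S.a j n) : S.e i m ≤ S.e j n :=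
  zpow_le_zpow_right₀ S.one_lt.le h

lemma Sys.e_lt {i j : ZMod f} {m n : ℤ} (h : S.a i m < S.a j n) : S.e i m < S.e j n :=
  zpow_lt_zpow_right₀ S.one_lt h

lemma Sys.e_le_mul {i j : ZMod f} {m n : ℤ} (h : S.a i m + 1 ≤ S.a j n) :
    (p:ℝ) * S.e i m ≤ S.e j n := by
  have h1 := S.one_lt
  have : (p:ℝ) * S.e i m = (p:ℝ) ^ (S.a i m + 1) := by
    unfold Sys.e; rw [zpow_add_one₀ (by positivity)]; ring
  rw [this]; exact zpow_le_zpow_right₀ h1.le h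

lemma sum_Ioc_add (g : ℤ → ℝ) {a b c : ℤ} (h1 : a ≤ b) (h2 : b ≤ c) :
    ∑ n ∈ Ioc a b, g n + ∑ n ∈ Ioc b c, g n = ∑ n ∈ Ioc a c, g n := by
  rw [← Finset.sum_union, Finset.Ioc_union_Ioc_eq_Ioc h1 h2]
  rw [Finset.disjoint_left]
  intro x; simp only [mem_Ioc]; omega

lemma Sys.C_sub (i : ZMod f) {l m : ℤ} (h : l ≤ m) :
    S.C i m - S.C i l = ∑ n ∈ Ioc l m, S.e i n := by
  unfold Sys.C
  rcases le_total 0 l with h0 | h0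
  · rw [Ioc_eq_empty_of_le h0, Ioc_eq_empty_of_le (h0.trans h), ← sum_Ioc_add _ h0 h]; simp
  · rcases le_total 0 m with h1 | h1
    · rw [Ioc_eq_empty_of_le h0, Ioc_eq_empty_of_le h1, ← sum_Ioc_add _ h0 h1]; simp; ring
    · rw [Ioc_eq_empty_of_le h0, Ioc_eq_empty_of_le h1, ← sum_Ioc_add _ h h1]; simp

lemma Sys.C_diff (i : ZMod f) (l m : ℤ) :
    S.C i m - S.C i l = ∑ n ∈ Ioc l m, S.e i n - ∑ n ∈ Ioc m l, S.e i n := by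
  rcases le_total l m with h | h
  · rw [S.C_sub i h, Ioc_eq_empty_of_le h]; simp
  · have := S.C_sub i h
    rw [← neg_sub, this, Ioc_eq_empty_of_le h]; simp

lemma sum_Ioc_shift (g : ℤ → ℝ) (l m t : ℤ) :
    ∑ n ∈ Ioc (l+t) (m+t), g n = ∑ n ∈ Ioc l m, g (n+t) := by
  rw [← Finset.image_add_right_Ioc, Finset.sum_image]
  intro a _ b _ h; simpa using h

lemma Sys.C_conv (i : ZMod f) {α β γ δ : ℤ} (h1 : α ≤ γ) (h2 : γ ≤ β) (h : γ + δ = α + β) :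
    S.C i γ + S.C i δ ≤ S.C i α + S.C i β := by
  have h3 := S.C_sub i h1
  have h4 := S.C_sub i (show δ ≤ β by omega)
  have h5 : ∑ n ∈ Ioc α γ, S.e i n ≤ ∑ n ∈ Ioc δ β, S.e i n := by
    have e1 : δ = α + (δ - α) := by ring
    have e2 : β = γ + (δ - α) := by omega
    rw [e2, show Ioc δ (γ + (δ-α)) = Ioc (α + (δ-α)) (γ+(δ-α)) by rw [← e1], sum_Ioc_shift]
    apply Finset.sum_le_sum
    intro n _
    apply S.e_mono
    omega
  linarith

lemma Sys.submod (x y : ZMod f → ℤ) : S.F (x ⊓ y) + S.F (x ⊔ y) ≤ S.F x + S.F y := by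
  unfold Sys.F
  rw [← Finset.sum_add_distrib, ← Finset.sum_add_distrib]
  apply Finset.sum_le_sum
  intro i _
  have hp : (0:ℤ) ≤ p := by positivity
  unfold E
  simp only [Pi.inf_apply, Pi.sup_apply]
  rcases le_total (x (i+1)) (y (i+1)) with h1 | h1 <;> rcases le_total (x i) (y i) with h2 | h2 <;>
    simp only [inf_of_le_left, inf_of_le_right, sup_of_le_left, sup_of_le_right, h1, h2]
  · rfl
  · have := mul_le_mul_of_nonneg_left h1 hp
    apply S.C_conv <;> linarith
  · have := mul_le_mul_of_nonneg_left h1 hp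
    rw [add_comm (S.C i (↑p * x (i+1) - x i))]
    apply S.C_conv <;> linarith
  · rw [add_comm]

lemma geom_Ioc (hp : (1:ℝ) < p) (m : ℤ) (b : ℤ) (h : m ≤ b) :
    ∑ c ∈ Ioc m b, ((p:ℝ) - 1) * (p:ℝ) ^ c = (p:ℝ)^(b+1) - (p:ℝ)^(m+1) := by
  induction b, h using Int.leInduction with
  | base => simp
  | succ n hn ih =>
    rw [← sum_Ioc_add _ hn (show n ≤ n + 1 by omega), ih]
    have : Ioc n (n+1) = {n+1} := by ext; simp; omega
    rw [this, sum_singleton, zpow_add_one₀ (by positivity) (n+1)]; ring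

lemma Sys.lemS (T : Finset (Σ _ : ZMod f, ℤ)) (b : ℤ) (hb : ∀ x ∈ T, S.a x.1 x.2 ≤ b) :
    ∑ x ∈ T, S.e x.1 x.2 ≤ (p:ℝ) ^ (b+1) := by
  classical
  have hp := S.one_lt
  have h2 := S.hp
  rcases T.eq_empty_or_nonempty with hT | hT
  · subst hT; simp; positivity
  obtain ⟨y, hy, hmin⟩ := T.exists_min_image (fun x => S.a x.1 x.2) hT
  set m := S.a y.1 y.2 - 1 with hm
  have hmap : ∀ x ∈ T, S.a x.1 x.2 ∈ Ioc m b := by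
    intro x hx
    have := hmin x hx
    have := hb x hx
    simp only [mem_Ioc]; omega
  rw [← Finset.sum_fiberwise_of_maps_to hmap]
  have hmb : m ≤ b := by have := hb y hy; omega
  calc _ ≤ ∑ c ∈ Ioc m b, ((p:ℝ) - 1) * (p:ℝ) ^ c := by
        apply Finset.sum_le_sum
        intro c _
        have h1 : ∑ x ∈ T with S.a x.1 x.2 = c, S.e x.1 x.2 =
            ((T.filter (fun x => S.a x.1 x.2 = c)).card : ℝ) * (p:ℝ)^c := by
          rw [Finset.sum_congr rfl (g := fun _ => (p:ℝ)^c)]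
          · simp
          · intro x hx
            simp only [mem_filter] at hx
            unfold Sys.e; rw [hx.2]
        rw [h1]
        apply mul_le_mul_of_nonneg_right _ (by positivity)
        have hcard : (T.filter (fun x => S.a x.1 x.2 = c)).card ≤ p - 1 := by
          set T' := T.filter (fun x => S.a x.1 x.2 = c)
          rcases T'.eq_empty_or_nonempty with h | h
          · rw [h]; simp
          obtain ⟨z, hz, hzm⟩ := T'.exists_min_image (fun x => x.2) h
          have hz' := (mem_filter.1 hz).2
          have hle : T'.card ≤ (Ico z.2 (z.2 + ((p:ℤ)-1))).card := by
            apply Finset.card_le_card_of_injOn (fun x => x.2)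
            · intro x hx
              have hx0 : x ∈ T' := hx
              have hx' := (mem_filter.1 hx0).2
              have h3 := hzm x hx0
              have h4 : x.1 = z.1 := by rw [← S.cls x.1 x.2, ← S.cls z.1 z.2, hx', hz']
              simp only [coe_Ico, Set.mem_Ico]
              refine ⟨h3, ?_⟩
              by_contra hcon
              have h5 := S.mono z.1 (not_lt.1 hcon)
              have h6 := S.step z.1 z.2
              have h7 : 0 < f := Nat.pos_of_ne_zero (NeZero.ne f)
              rw [h4] at hx'
              omega
            · intro x hx x' hx' hxx
              have hx := (mem_filter.1 hx).2
              have hx' := (mem_filter.1 hx').2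
              have h4 : x.1 = x'.1 := by rw [← S.cls x.1 x.2, ← S.cls x'.1 x'.2, hx', hx]
              exact Sigma.ext h4 (heq_of_eq hxx)
          rw [Int.card_Ico] at hle
          omega
        have : ((p - 1 : ℕ) : ℝ) = (p:ℝ) - 1 := by rw [Nat.cast_sub (by omega)]; simp
        rw [← this]
        exact_mod_cast hcard
    _ = (p:ℝ)^(b+1) - (p:ℝ)^(m+1) := geom_Ioc hp m b hmb
    _ ≤ _ := by
      have : 0 ≤ (p:ℝ)^(m+1) := by positivity
      linarith

end
end Sheats
namespace Sheats
open Finset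
section
variable {p f : ℕ} [NeZero f] (S : Sys p f)

def Sys.H (z B : ZMod f → ℤ) : Prop :=
  ∀ u : ZMod f → ℤ, 0 ≤ u → u ≠ 0 → z + u ≤ B → S.F z < S.F (z + u)

lemma Sys.F_diff (x u : ZMod f → ℤ) : S.F (x + u) - S.F x =
    ∑ j, ∑ n ∈ Ioc (E p x j) (E p x j + E p u j), S.e j n -
      ∑ j, ∑ n ∈ Ioc (E p x j + E p u j) (E p x j), S.e j n := by
  unfold Sys.F
  rw [← Finset.sum_sub_distrib, ← Finset.sum_sub_distrib]
  apply Finset.sum_congr rfl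
  intro j _
  rw [S.C_diff, E_add]

lemma Sys.TL {z B u : ZMod f → ℤ} (hH : S.H z B) (hu : 0 ≤ u) (hB : z + u ≤ B) (i : ZMod f)
    (hi : 1 ≤ u i) (hE : E p u i ≤ 0) :
    ∃ v : ZMod f → ℤ, 0 ≤ v ∧ v ≤ u ∧ v i = 1 ∧ E p v i = -1 ∧
      (∀ j, j ≠ i → 0 ≤ E p v j ∧ E p v j ≤ max 0 (E p u j)) ∧
      ∃ j, j ≠ i ∧ 0 < E p v j ∧ E p v j ≤ E p u j ∧
        S.a i (E p z i) + 1 ≤ S.a j (E p z j + E p v j) := by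
  obtain ⟨v, hv0, hvu, hvi, hEi, hEj⟩ := tree S.hp u hu i hi hE
  refine ⟨v, hv0, hvu, hvi, hEi, hEj, ?_⟩
  by_contra hcon
  push Not at hcon
  have hF : S.F z < S.F (z + v) := by
    apply hH v hv0
    · intro h; rw [h] at hvi; simp at hvi
    · exact (add_le_add_right hvu z).trans hB
  have hd := S.F_diff z v
  have h1 : ∑ j, ∑ n ∈ Ioc (E p z j + E p v j) (E p z j), S.e j n = S.e i (E p z i) := by
    rw [Finset.sum_eq_single i]
    · rw [hEi]
      have : Ioc (E p z i + -1) (E p z i) = {E p z i} := by ext; simp; omega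
      rw [this, sum_singleton]
    · intro j _ hj
      rw [Ioc_eq_empty_of_le, sum_empty]
      have := (hEj j hj).1
      omega
    · simp
  have h2 : ∑ j, ∑ n ∈ Ioc (E p z j) (E p z j + E p v j), S.e j n ≤
      (p:ℝ) ^ (S.a i (E p z i) - 1 + 1) := by
    rw [← Finset.sum_sigma univ (fun j => Ioc (E p z j) (E p z j + E p v j))
      (fun x => S.e x.1 x.2)]
    apply S.lemS
    rintro ⟨j, n⟩ hx
    simp only [mem_sigma, mem_univ, true_and, mem_Ioc] at hx
    have hji : j ≠ i := by
      rintro rfl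
      rw [hEi] at hx; omega
    have h3 := hEj j hji
    have h4 := hcon j hji (by omega) (by
      rcases le_total 0 (E p u j) with h | h
      · rw [max_eq_right h] at h3; exact h3.2
      · rw [max_eq_left h] at h3; omega)
    have h5 := S.mono j hx.2
    have h6 : S.a j n ≠ S.a i (E p z i) := by
      intro h
      apply hji
      rw [← S.cls j n, ← S.cls i (E p z i), h]
    simp only
    omega
  rw [sub_add_cancel] at h2
  unfold Sys.e at h1
  unfold Sys.e at hd
  unfold Sys.e at h2
  linarith

noncomputable def Sys.Add (z u : ZMod f → ℤ) : ℝ :=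
  ∑ j, ∑ n ∈ Ioc (E p z j) (E p z j + E p u j), S.e j n
noncomputable def Sys.Rem (z u : ZMod f → ℤ) : ℝ :=
  ∑ j, ∑ n ∈ Ioc (E p z j + E p u j) (E p z j), S.e j n

lemma Sys.L {z B : ZMod f → ℤ} (hH : S.H z B) : ∀ (N : ℕ) (u : ZMod f → ℤ), 0 ≤ u → z + u ≤ B →
    ∑ j, u j ≤ N → (p:ℝ) * S.Rem z u ≤ S.Add z u := by
  classical
  have hp := S.one_lt
  intro N
  induction N with
  | zero =>
    intro u hu hB hs
    have h0 : u = 0 := by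
      ext j
      have h1 := Finset.single_le_sum (f := u) (fun j _ => hu j) (mem_univ j)
      have h2 := hu j
      simp at h2 hs ⊢
      omega
    subst h0
    simp [Sys.Rem, Sys.Add, E]
  | succ N ih =>
    intro u hu hB hs
    by_cases hneg : ∃ i, E p u i < 0
    · obtain ⟨i, hi⟩ := hneg
      have hui : 1 ≤ u i := by
        have h1 := hu (i+1)
        have h2 : 0 ≤ (p:ℤ) * u (i+1) := by simp at h1; positivity
        unfold E at hi
        omega
      obtain ⟨v, hv0, hvu, hvi, hEi, hEj, j0, hj0, hv1, hv2, hv3⟩ := S.TL hH hu hB i hui hi.le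
      have hih := ih (u - v) (sub_nonneg.2 hvu) (le_trans (by
          intro j; have := hv0 j; simp at this ⊢; omega) hB) (by
        simp only [Pi.sub_apply, Finset.sum_sub_distrib]
        have := Finset.single_le_sum (f := v) (fun j _ => hv0 j) (mem_univ i)
        push_cast at hs
        omega)
      have hA : S.Add z (u - v) + S.e j0 (E p z j0 + E p u j0) ≤ S.Add z u := by
        unfold Sys.Add
        rw [← Finset.add_sum_erase univ _ (mem_univ j0), ← Finset.add_sum_erase univ (fun j => ∑ n ∈ Ioc (E p z j) (E p z j + E p u j), S.e j n) (mem_univ j0)]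
        have h1 : ∑ n ∈ Ioc (E p z j0) (E p z j0 + E p (u-v) j0), S.e j0 n + S.e j0 (E p z j0 + E p u j0)
            ≤ ∑ n ∈ Ioc (E p z j0) (E p z j0 + E p u j0), S.e j0 n := by
          rw [E_sub, ← Finset.sum_erase_add (Ioc (E p z j0) (E p z j0 + E p u j0)) _ (show E p z j0 + E p u j0 ∈ _ by simp; omega)]
          refine add_le_add ?_ le_rfl
          apply Finset.sum_le_sum_of_subset_of_nonneg
          · intro n; simp; omega
          · intro n _ _; exact (S.e_pos _ _).le
        have h2 : ∑ j ∈ univ.erase j0, ∑ n ∈ Ioc (E p z j) (E p z j + E p (u-v) j), S.e j n ≤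
            ∑ j ∈ univ.erase j0, ∑ n ∈ Ioc (E p z j) (E p z j + E p u j), S.e j n := by
          apply Finset.sum_le_sum
          intro j _
          apply Finset.sum_le_sum_of_subset_of_nonneg
          · intro n
            rw [E_sub]
            by_cases hji : j = i
            · subst hji; simp; omega
            · have := hEj j hji
              simp; omega
          · intro n _ _; exact (S.e_pos _ _).le
        linarith
      have hR : S.Rem z u ≤ S.Rem z (u - v) + S.e i (E p z i) := by
        unfold Sys.Rem
        rw [← Finset.add_sum_erase univ _ (mem_univ i), ← Finset.add_sum_erase univ (fun j => ∑ n ∈ Ioc (E p z j + E p (u-v) j) (E p z j), S.e j n) (mem_univ i)]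
        have h1 : ∑ n ∈ Ioc (E p z i + E p u i) (E p z i), S.e i n ≤
            ∑ n ∈ Ioc (E p z i + E p (u-v) i) (E p z i), S.e i n + S.e i (E p z i) := by
          rw [E_sub, hEi, ← sum_Ioc_add _ (show E p z i + E p u i ≤ E p z i + (E p u i - -1) by omega) (by omega)]
          have : Ioc (E p z i + E p u i) (E p z i + (E p u i - -1)) = {E p z i + E p u i + 1} := by
            ext; simp; omega
          rw [this, sum_singleton, add_comm]
          gcongr
          apply S.e_mono; omega
        have h2 : ∑ j ∈ univ.erase i, ∑ n ∈ Ioc (E p z j + E p u j) (E p z j), S.e j n ≤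
            ∑ j ∈ univ.erase i, ∑ n ∈ Ioc (E p z j + E p (u-v) j) (E p z j), S.e j n := by
          apply Finset.sum_le_sum
          intro j hj
          apply Finset.sum_le_sum_of_subset_of_nonneg
          · intro n
            rw [E_sub]
            have := hEj j (mem_erase.1 hj).1
            simp; omega
          · intro n _ _; exact (S.e_pos _ _).le
        linarith
      have h3 : (p:ℝ) * S.e i (E p z i) ≤ S.e j0 (E p z j0 + E p u j0) :=
        (S.e_le_mul hv3).trans (S.e_mono _ (by omega))
      nlinarith
    · push Not at hneg
      have h0 : S.Rem z u = 0 := by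
        unfold Sys.Rem
        apply Finset.sum_eq_zero
        intro j _
        rw [Ioc_eq_empty_of_le, sum_empty]
        have := hneg j; omega
      rw [h0, mul_zero]
      exact Finset.sum_nonneg fun j _ => Finset.sum_nonneg fun n _ => (S.e_pos _ _).le

/-- Nestedness. -/
lemma Sys.nested {x1 x2 c B : ZMod f → ℤ} (hmin : ∀ x, c ≤ x → x ≤ B → S.F x1 ≤ S.F x)
    (hB : x1 ≤ B) (hH : S.H x2 (x1 - 1)) (hc : c - 1 ≤ x2) (h12 : x2 + 1 ≤ x1) (i : ZMod f) :
    0 ≤ E p (x1 - x2) i := by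
  by_contra hneg
  push Not at hneg
  set y := x1 - x2 with hy
  have hp : (2:ℤ) ≤ p := by exact_mod_cast S.hp
  have hy1 : ∀ j, 1 ≤ y j := by
    intro j; have := h12 j; simp [hy] at this ⊢; omega
  have hEu : ∀ j, E p (y - 1) j = E p y j - ((p:ℤ)-1) := by
    intro j; simp [E]; ring
  have hyi : (p:ℤ) + 1 ≤ y i := by
    have := hy1 (i+1)
    unfold E at hneg
    nlinarith
  obtain ⟨v, hv0, hvu, hvi, hEi, hEj, j0, hj0, hv1, hv2, hv3⟩ := S.TL (u := y - 1) hH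
    (by intro j; have := hy1 j; simp; omega) (by intro j; simp [hy]; omega) i (by simp; omega)
    (by rw [hEu]; omega)
  have hle := hmin (x1 - v) (by
      intro j
      have h1 := hvu j
      have h2 := hc j
      simp [hy] at h1 h2 ⊢; omega)
    (le_trans (by intro j; have := hv0 j; simp at this ⊢; omega) hB)
  have hd := S.F_diff (x1 - v) v
  rw [sub_add_cancel] at hd
  have hx1 : ∀ j, E p x1 j = E p x2 j + E p y j := by
    intro j; rw [hy, E_sub]; ring
  have h1 : ∑ j, ∑ n ∈ Ioc (E p (x1 - v) j + E p v j) (E p (x1 - v) j), S.e j n = S.e i (E p x1 i + 1) := by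
    rw [Finset.sum_eq_single i]
    · rw [E_sub, hEi]
      have : Ioc (E p x1 i - -1 + -1) (E p x1 i - -1) = {E p x1 i + 1} := by ext; simp; omega
      rw [this, sum_singleton]
    · intro j _ hj
      rw [Ioc_eq_empty_of_le, sum_empty]
      have := (hEj j hj).1
      omega
    · simp
  have h2 : S.e j0 (E p x1 j0) ≤ ∑ j, ∑ n ∈ Ioc (E p (x1-v) j) (E p (x1-v) j + E p v j), S.e j n := by
    refine le_trans ?_ (Finset.single_le_sum (f := fun j => ∑ n ∈ Ioc (E p (x1-v) j) (E p (x1-v) j + E p v j), S.e j n) (fun j _ => Finset.sum_nonneg fun n _ => (S.e_pos _ _).le) (mem_univ j0))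
    refine Finset.single_le_sum (f := fun n => S.e j0 n) (fun n _ => (S.e_pos _ _).le) ?_
    rw [E_sub]; simp; omega
  have h3 : S.e i (E p x1 i + 1) < S.e j0 (E p x1 j0) := by
    apply S.e_lt
    have h4 := S.mono i (show E p x1 i + 1 ≤ E p x2 i by rw [hx1]; omega)
    have h5 := S.mono j0 (show E p x2 j0 + E p v j0 ≤ E p x1 j0 by
      rw [hx1]; have := hEu j0; omega)
    omega
  linarith

lemma sum_E (u : ZMod f → ℤ) : ∑ i, E p u i = ((p:ℤ) - 1) * ∑ i, u i := by
  unfold E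
  have := Equiv.sum_comp (Equiv.addRight (1:ZMod f)) u
  simp only [Equiv.coe_addRight] at this
  rw [Finset.sum_sub_distrib, ← Finset.mul_sum, this]
  ring

lemma sum_E_wt (y : ZMod f → ℤ) : ∑ i, (p:ℤ)^(i.val) * E p y i =
    ∑ i : ZMod f, y (i+1) * ((p:ℤ)^(i.val + 1) - (p:ℤ)^((i+1).val)) := by
  have : ∑ i : ZMod f, y (i+1) * (p:ℤ)^((i+1).val) = ∑ i : ZMod f, y i * (p:ℤ)^(i.val) :=
    Equiv.sum_comp (Equiv.addRight (1:ZMod f)) (fun i => y i * (p:ℤ)^(i.val))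
  simp only [mul_sub, Finset.sum_sub_distrib, this, E]
  congr 1
  · apply Finset.sum_congr rfl; intro i _; ring
  · apply Finset.sum_congr rfl; intro i _; ring

lemma val_succ_le (i : ZMod f) : (i+1).val ≤ i.val + 1 := by
  refine (ZMod.val_add_le i 1).trans ?_
  have : (1 : ZMod f).val ≤ 1 := by
    rcases Nat.eq_or_lt_of_le (Nat.one_le_iff_ne_zero.2 (NeZero.ne f)) with h | h
    · subst h; exact (ZMod.val_lt _).le
    · have : Fact (1 < f) := ⟨h⟩
      rw [ZMod.val_one]
  omega

lemma Sys.C_ge_pos (i : ZMod f) (n : ℤ) (hn : 0 ≤ n) : (n:ℝ) * (p:ℝ)^(i.val) ≤ S.C i n := by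
  unfold Sys.C
  rw [Ioc_eq_empty_of_le hn, sum_empty, sub_zero]
  have : ∑ m ∈ Ioc 0 n, (p:ℝ)^(i.val) = (n:ℝ) * (p:ℝ)^(i.val) := by
    simp only [sum_const, Int.card_Ioc, sub_zero, nsmul_eq_mul]
    congr 1
    exact_mod_cast Int.toNat_of_nonneg hn
  rw [← this]
  apply Finset.sum_le_sum
  intro m hm
  rw [← zpow_natCast]
  exact zpow_le_zpow_right₀ S.one_lt.le (S.pos i m (by simp at hm; omega))

lemma Sys.C_gt_neg (i : ZMod f) (n : ℤ) (hn : n < 0) : (n:ℝ) * (p:ℝ)^(i.val) < S.C i n := by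
  unfold Sys.C
  rw [Ioc_eq_empty_of_le hn.le, sum_empty, zero_sub]
  have : ∑ m ∈ Ioc n 0, (p:ℝ)^(i.val) = -(n:ℝ) * (p:ℝ)^(i.val) := by
    simp only [sum_const, Int.card_Ioc, zero_sub, nsmul_eq_mul]
    congr 1
    have := Int.toNat_of_nonneg (show 0 ≤ -n by omega)
    exact_mod_cast this
  have h2 : ∑ m ∈ Ioc n 0, S.e i m < ∑ m ∈ Ioc n 0, (p:ℝ)^(i.val) := by
    apply Finset.sum_lt_sum_of_nonempty
    · simp; omega
    intro m hm
    rw [← zpow_natCast]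
    exact zpow_lt_zpow_right₀ S.one_lt (S.neg i m (by simp at hm; omega))
  linarith

lemma Sys.F_zero : S.F 0 = 0 := by simp [Sys.F, E, Sys.C]

lemma Sys.H0 (B : ZMod f → ℤ) : S.H 0 B := by
  intro u hu hne _
  have hp := S.one_lt
  have h2 := S.hp
  rw [zero_add, S.F_zero]
  have hge : ∀ i, (E p u i : ℝ) * (p:ℝ)^(i.val) ≤ S.C i (E p u i) := by
    intro i
    rcases le_or_gt 0 (E p u i) with h | h
    · exact S.C_ge_pos i _ h
    · exact (S.C_gt_neg i _ h).le
  have hsum : 0 ≤ ∑ i : ZMod f, (E p u i : ℝ) * (p:ℝ)^(i.val) := by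
    have h1 := sum_E_wt (p := p) u
    have h3 : 0 ≤ ∑ i, (p:ℤ)^(i.val) * E p u i := by
      rw [h1]
      apply Finset.sum_nonneg
      intro i _
      apply mul_nonneg (hu _)
      rw [sub_nonneg]
      have hp1 : (1:ℤ) ≤ p := by exact_mod_cast (by omega : 1 ≤ p)
      exact pow_le_pow_right₀ hp1 (val_succ_le i)
    have h4 : ((∑ i, (p:ℤ)^(i.val) * E p u i : ℤ) : ℝ) = ∑ i : ZMod f, (E p u i : ℝ) * (p:ℝ)^(i.val) := by
      push_cast
      apply Finset.sum_congr rfl; intro i _; ring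
    rw [← h4]
    exact_mod_cast h3
  by_cases hneg : ∃ i, E p u i < 0
  · obtain ⟨i, hi⟩ := hneg
    refine lt_of_le_of_lt hsum ?_
    exact Finset.sum_lt_sum (fun i _ => hge i) ⟨i, mem_univ i, S.C_gt_neg i _ hi⟩
  · push Not at hneg
    have h5 : 0 < ∑ i, E p u i := by
      rw [sum_E]
      apply mul_pos (by have : (2:ℤ) ≤ p := by exact_mod_cast h2
                        omega)
      apply lt_of_le_of_ne (Finset.sum_nonneg fun i _ => hu i)
      intro h
      apply hne
      ext j
      exact (Finset.sum_eq_zero_iff_of_nonneg (fun i _ => hu i)).1 h.symm j (mem_univ j)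
    obtain ⟨i, _, hi⟩ := Finset.exists_lt_of_sum_lt (s := univ) (f := fun _ : ZMod f => (0:ℤ)) (g := fun i => E p u i) (by simpa using h5)
    refine lt_of_lt_of_le ?_ (Finset.sum_le_sum (fun i _ => hge i))
    apply Finset.sum_pos'
    · intro i _
      have := hneg i
      have : (0:ℝ) ≤ E p u i := by exact_mod_cast this
      positivity
    · refine ⟨i, mem_univ i, ?_⟩
      have : (0:ℝ) < E p u i := by exact_mod_cast hi
      positivity

end
end Sheats
namespace Sheats
open Finset
section
variable {p f : ℕ} [NeZero f] (S : Sys p f)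

lemma Sys.a_shift (i : ZMod f) (n : ℤ) (s : ℕ) : S.a i (n - s * ((p:ℤ)-1)) + s * f ≤ S.a i n := by
  induction s with
  | zero => simp
  | succ s ih =>
    have := S.step i (n - (s+1:ℕ) * ((p:ℤ)-1))
    have h : n - (s+1:ℕ) * ((p:ℤ)-1) + ((p:ℤ)-1) = n - s * ((p:ℤ)-1) := by push_cast; ring
    rw [h] at this
    push_cast at this ⊢
    linarith

lemma Sys.e_shift (i : ZMod f) (n : ℤ) (s : ℕ) :
    S.e i (n - s * ((p:ℤ)-1)) ≤ (((p:ℝ)^f)⁻¹)^s * S.e i n := by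
  have hp := S.one_lt
  have h := zpow_le_zpow_right₀ hp.le (S.a_shift i n s)
  rw [zpow_add₀ (by positivity)] at h
  have h2 : (p:ℝ)^((s:ℤ) * f) = ((p:ℝ)^f)^s := by
    rw [mul_comm, zpow_mul]; norm_cast
  rw [h2] at h
  unfold Sys.e
  rw [inv_pow, inv_mul_eq_div, le_div_iff₀ (by positivity)]
  exact h

lemma Sys.term_ge (z X : ZMod f → ℤ) (s : ℕ) :
    - ((((p:ℝ)^f)⁻¹)^s * S.Rem z (X - z)) ≤
      S.F (X - fun _ => (s:ℤ)) - S.F (z - fun _ => (s:ℤ)) := by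
  have h := S.F_diff (z - fun _ => (s:ℤ)) (X - z)
  have h1 : (z - fun _ => (s:ℤ)) + (X - z) = X - fun _ => (s:ℤ) := by ext; simp
  rw [h1] at h
  rw [h]
  have hA : 0 ≤ ∑ j, ∑ n ∈ Ioc (E p (z - fun _ => (s:ℤ)) j) (E p (z - fun _ => (s:ℤ)) j + E p (X - z) j), S.e j n :=
    Finset.sum_nonneg fun j _ => Finset.sum_nonneg fun n _ => (S.e_pos _ _).le
  have hR : ∑ j, ∑ n ∈ Ioc (E p (z - fun _ => (s:ℤ)) j + E p (X - z) j) (E p (z - fun _ => (s:ℤ)) j), S.e j n ≤ (((p:ℝ)^f)⁻¹)^s * S.Rem z (X - z) := by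
    unfold Sys.Rem
    rw [Finset.mul_sum]
    apply Finset.sum_le_sum
    intro j _
    rw [Finset.mul_sum, E_shift]
    have e1 : E p z j - s * ((p:ℤ)-1) + E p (X - z) j = (E p z j + E p (X-z) j) + -(s * ((p:ℤ)-1)) := by ring
    have e2 : E p z j - s * ((p:ℤ)-1) = E p z j + -(s * ((p:ℤ)-1)) := by ring
    rw [e1, e2, sum_Ioc_shift]
    apply Finset.sum_le_sum
    intro n _
    exact S.e_shift j n s
  linarith

lemma geom_small {q P : ℝ} (hP : 1 < P) (hq : P + 1 ≤ q) (d : ℕ) :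
    P * ∑ s ∈ range d, (q⁻¹)^(s+1) < 1 := by
  have hq0 : 0 < q := by linarith
  have h : (q - 1) * ∑ s ∈ range d, (q⁻¹)^(s+1) = 1 - (q⁻¹)^d := by
    induction d with
    | zero => simp
    | succ d ih =>
      rw [sum_range_succ, mul_add, ih, pow_succ]
      field_simp
      ring
  have h1 : 0 < (q⁻¹)^d := by positivity
  have h2 : 0 ≤ ∑ s ∈ range d, (q⁻¹)^(s+1) := Finset.sum_nonneg fun _ _ => by positivity
  nlinarith

lemma Sys.lemB {z B : ZMod f → ℤ} (hH : S.H z B) (d : ℕ) (X : ℕ → ZMod f → ℤ)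
    (hz : ∀ s < d + 1, z ≤ X s) (hX : ∀ s < d + 1, X s ≤ X 0) (hB : X 0 ≤ B) (hne : X 0 ≠ z) :
    ∑ s ∈ range (d+1), S.F (z - fun _ => (s:ℤ)) < ∑ s ∈ range (d+1), S.F (X s - fun _ => (s:ℤ)) := by
  classical
  have hp := S.one_lt
  have h2 := S.hp
  have hu0 : 0 ≤ X 0 - z := sub_nonneg.2 (hz 0 (by omega))
  have hzu : z + (X 0 - z) = X 0 := by ext; simp
  have hL := S.L hH (∑ j, (X 0 - z) j).toNat (X 0 - z) hu0 (by rw [hzu]; exact hB) (Int.self_le_toNat _)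
  set T : Finset (ZMod f) := univ.filter (fun j => 0 < E p (X 0 - z) j) with hT
  have hTn : T.Nonempty := by
    have h5 : 0 < ∑ i, E p (X 0 - z) i := by
      rw [sum_E]
      apply mul_pos
      · have : (2:ℤ) ≤ p := by exact_mod_cast h2
        omega
      apply lt_of_le_of_ne (Finset.sum_nonneg fun i _ => hu0 i)
      intro h
      apply hne
      ext j
      have := (Finset.sum_eq_zero_iff_of_nonneg (fun i _ => hu0 i)).1 h.symm j (mem_univ j)
      simp at this
      omega
    obtain ⟨i, _, hi⟩ := Finset.exists_lt_of_sum_lt (s := univ) (f := fun _ : ZMod f => (0:ℤ)) (g := fun i => E p (X 0 - z) i) (by simpa using h5)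
    exact ⟨i, by simpa [hT] using hi⟩
  obtain ⟨l, hl, hlmax⟩ := T.exists_max_image (fun j => S.a j (E p z j + E p (X 0 - z) j)) hTn
  simp only [hT, mem_filter, mem_univ, true_and] at hl hlmax
  set b := S.a l (E p z l + E p (X 0 - z) l) with hb
  have hAdd : (p:ℝ)^b ≤ S.Add z (X 0 - z) := by
    refine le_trans ?_ (Finset.single_le_sum (f := fun j => ∑ n ∈ Ioc (E p z j) (E p z j + E p (X 0 - z) j), S.e j n) (fun j _ => Finset.sum_nonneg fun n _ => (S.e_pos _ _).le) (mem_univ l))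
    refine Finset.single_le_sum (f := fun n => S.e l n) (a := E p z l + E p (X 0 - z) l) (fun n _ => (S.e_pos _ _).le) ?_
    simp; omega
  have hb0 : 0 < (p:ℝ)^b := by positivity
  have h0 : (1 - 1/(p:ℝ)) * (p:ℝ)^b ≤ S.F (X 0) - S.F z := by
    have := S.F_diff z (X 0 - z)
    rw [hzu] at this
    rw [this]
    change _ ≤ S.Add z (X 0 - z) - S.Rem z (X 0 - z)
    have h3 : S.Rem z (X 0 - z) ≤ 1/(p:ℝ) * S.Add z (X 0 - z) := by
      rw [one_div, inv_mul_eq_div, le_div_iff₀ (by positivity)]; linarith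
    have h4 : 0 < 1 - 1/(p:ℝ) := by
      have : 1/(p:ℝ) < 1 := by rw [div_lt_one (by positivity)]; exact hp
      linarith
    nlinarith
  have hRem : ∀ s < d + 1, S.Rem z (X s - z) ≤ ((p:ℝ) - 1) * (p:ℝ)^b := by
    intro s hs
    set T' : Finset (Σ _ : ZMod f, ℤ) := univ.sigma (fun j => Ioc (E p z j + E p (X s - z) j) (E p z j)) with hT'
    have hnm : (⟨l, E p z l + E p (X 0 - z) l⟩ : Σ _ : ZMod f, ℤ) ∉ T' := by
      simp [hT']; omega
    have hS := S.lemS (insert ⟨l, E p z l + E p (X 0 - z) l⟩ T') b (by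
      intro x hx
      rw [mem_insert] at hx
      rcases hx with rfl | hx
      · exact le_rfl
      · obtain ⟨i, n⟩ := x
        simp only [hT', mem_sigma, mem_univ, true_and, mem_Ioc] at hx
        simp only
        have hn := S.mono i hx.2
        have hEi : E p (X s - z) i < 0 := by omega
        have hui : 1 ≤ (X s - z) i := by
          have h1 := hz s hs (i+1)
          have h3 : 0 ≤ (p:ℤ) * (X s - z) (i+1) := by
            apply mul_nonneg (by positivity)
            simp; omega
          unfold E at hEi
          omega
        have hui0 : 1 ≤ (X 0 - z) i := by
          have : X s i ≤ X 0 i := hX s hs i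
          simp at hui ⊢; omega
        rcases le_or_gt (E p (X 0 - z) i) 0 with h | h
        · obtain ⟨v, _, _, _, _, _, j0, hj0, hv1, hv2, hv3⟩ := S.TL hH hu0 (by rw [hzu]; exact hB) i hui0 h
          have h5 := hlmax j0 (by omega)
          have h6 := S.mono j0 (show E p z j0 + E p v j0 ≤ E p z j0 + E p (X 0 - z) j0 by omega)
          omega
        · have h5 := hlmax i h
          have h6 := S.mono i (show E p z i ≤ E p z i + E p (X 0 - z) i by omega)
          omega)
    rw [Finset.sum_insert hnm, Finset.sum_sigma, zpow_add_one₀ (by positivity)] at hS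
    change (p:ℝ)^b + S.Rem z (X s - z) ≤ _ at hS
    linarith
  rw [sum_range_succ', sum_range_succ']
  have hz0 : (z - fun _ => ((0:ℕ):ℤ)) = z := by ext; simp
  have hX0 : (X 0 - fun _ => ((0:ℕ):ℤ)) = X 0 := by ext; simp
  rw [hz0, hX0]
  have hpos : 0 < (1 - 1/(p:ℝ)) * (p:ℝ)^b := by
    have : 1/(p:ℝ) < 1 := by rw [div_lt_one (by positivity)]; exact hp
    have h4 : 0 < 1 - 1/(p:ℝ) := by linarith
    positivity
  by_cases hf : f = 1
  · have : ∀ s ∈ range d, S.F (z - fun _ => ((s+1:ℕ):ℤ)) ≤ S.F (X (s+1) - fun _ => ((s+1:ℕ):ℤ)) := by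
      intro s hs
      have h3 := S.term_ge z (X (s+1)) (s+1)
      have h4 : S.Rem z (X (s+1) - z) = 0 := by
        unfold Sys.Rem
        apply Finset.sum_eq_zero
        intro j _
        rw [Ioc_eq_empty_of_le, sum_empty]
        have : j + 1 = j := by subst hf; exact Subsingleton.elim _ _
        unfold E
        rw [this]
        have h5 := hz (s+1) (by simp at hs; omega) j
        have h6 : 0 ≤ (X (s+1) - z) j := by simp; omega
        have h7 : (2:ℤ) ≤ p := by exact_mod_cast h2
        nlinarith
      rw [h4] at h3
      linarith
    have := Finset.sum_le_sum this
    linarith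
  · have hf2 : 2 ≤ f := by
      have := NeZero.ne f
      omega
    have hq : (p:ℝ) + 1 ≤ (p:ℝ)^f := by
      have h3 : (p:ℝ)^2 ≤ (p:ℝ)^f := pow_le_pow_right₀ hp.le hf2
      have h4 : (2:ℝ) ≤ p := by exact_mod_cast h2
      nlinarith
    have hg := geom_small hp hq d
    have : ∀ s ∈ range d, S.F (z - fun _ => ((s+1:ℕ):ℤ)) - S.F (X (s+1) - fun _ => ((s+1:ℕ):ℤ)) ≤ (((p:ℝ)^f)⁻¹)^(s+1) * (((p:ℝ) - 1) * (p:ℝ)^b) := by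
      intro s hs
      have h3 := S.term_ge z (X (s+1)) (s+1)
      have h4 := hRem (s+1) (by simp at hs; omega)
      have h5 : (((p:ℝ)^f)⁻¹)^(s+1) * S.Rem z (X (s+1) - z) ≤ (((p:ℝ)^f)⁻¹)^(s+1) * (((p:ℝ) - 1) * (p:ℝ)^b) := by
        gcongr
      linarith
    have := Finset.sum_le_sum this
    rw [Finset.sum_sub_distrib, ← Finset.sum_mul] at this
    set G := ∑ s ∈ range d, (((p:ℝ)^f)⁻¹)^(s+1)
    have h6 : G < 1/(p:ℝ) := by
      rw [lt_div_iff₀ (by positivity)]; linarith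
    have h7 : 0 < ((p:ℝ) - 1) * (p:ℝ)^b := mul_pos (by linarith) hb0
    have h8 : (1 - 1/(p:ℝ)) * (p:ℝ)^b = 1/(p:ℝ) * (((p:ℝ) - 1) * (p:ℝ)^b) := by
      field_simp
    nlinarith

lemma chain_bound {d : ℕ} {x : ℕ → ZMod f → ℤ} (h : ∀ s < d, x (s+1) + 1 ≤ x s) (j : ZMod f) :
    ∀ s ≤ d, x s j + s ≤ x 0 j := by
  intro s
  induction s with
  | zero => simp
  | succ s ih =>
    intro hs
    have h1 := h s (by omega) j
    have h2 := ih (by omega)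
    simp at h1 ⊢
    omega

theorem Sys.core (d : ℕ) : ∀ B : ZMod f → ℤ, (fun _ => (d:ℤ)) ≤ B → ∃ z : ℕ → ZMod f → ℤ,
    z d = 0 ∧ z 0 ≤ B ∧ (fun _ => (d:ℤ)) ≤ z 0 ∧ (∀ s < d, z (s+1) + 1 ≤ z s) ∧
    (∀ s < d, ∀ i, 0 ≤ E p (z s - z (s+1)) i) ∧
    (∀ x, (fun _ => (d:ℤ)) ≤ x → x ≤ B → S.F (z 0) ≤ S.F x) ∧ S.H (z 0) B ∧
    ∀ x : ℕ → ZMod f → ℤ, x d = 0 → x 0 ≤ B → (∀ s < d, x (s+1) + 1 ≤ x s) →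
      ∑ s ∈ range d, S.F (z s) ≤ ∑ s ∈ range d, S.F (x s) ∧
      (∑ s ∈ range d, S.F (x s) = ∑ s ∈ range d, S.F (z s) → 0 < d → S.F (x 0) = S.F (z 0)) := by
  classical
  induction d with
  | zero =>
    intro B hB
    refine ⟨fun _ => 0, rfl, fun j => by simpa using hB j, by simp [Pi.le_def], by simp, by simp, ?_, S.H0 B, by simp⟩
    intro x hx hxB
    by_cases h : x = 0
    · rw [h]
    · have := S.H0 B x (fun j => by simpa using hx j) h (by simpa using hxB)
      rw [zero_add] at this
      exact this.le
  | succ d ih =>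
    intro B hB
    let D : ZMod f → ℤ := fun _ => ((d+1:ℕ):ℤ)
    have hne : (Icc D B).Nonempty := ⟨B, by simp only [mem_Icc]; exact ⟨hB, le_rfl⟩⟩
    obtain ⟨m, hm, hmin⟩ := (Icc D B).exists_min_image S.F hne
    obtain ⟨z0, hz0, hmax⟩ := ((Icc D B).filter (fun x => S.F x = S.F m)).exists_max_image
      (fun x => ∑ j, x j) ⟨m, mem_filter.2 ⟨hm, rfl⟩⟩
    simp only [mem_filter, mem_Icc] at hz0 hmax hmin
    obtain ⟨⟨hDz, hzB⟩, hFz⟩ := hz0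
    have hmin' : ∀ x, D ≤ x → x ≤ B → S.F z0 ≤ S.F x := by
      intro x h1 h2; rw [hFz]; exact hmin x ⟨h1, h2⟩
    have hH : S.H z0 B := by
      intro u hu hu0 hB'
      have hle : D ≤ z0 + u := hDz.trans (le_add_of_nonneg_right hu)
      refine lt_of_le_of_ne (hmin' _ hle hB') ?_
      intro heq
      have h1 := hmax (z0 + u) ⟨⟨hle, hB'⟩, by rw [← heq, hFz]⟩
      simp only [Pi.add_apply, Finset.sum_add_distrib] at h1
      apply hu0
      have h2 : ∑ j, u j = 0 := le_antisymm (by omega) (Finset.sum_nonneg fun i _ => hu i)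
      ext j
      exact (Finset.sum_eq_zero_iff_of_nonneg (fun i _ => hu i)).1 h2 j (mem_univ j)
    obtain ⟨z', hz'd, hz'B, hz'D, hz'c, hz'E, hz'min, hz'H, hz'opt⟩ := ih (z0 - 1) (by
      intro j; have := hDz j; simp [D] at this ⊢; omega)
    have hz'1 : z' 0 + 1 ≤ z0 := by intro j; have := hz'B j; simp at this ⊢; omega
    obtain ⟨Z, hZ0, hZs⟩ : ∃ Z : ℕ → ZMod f → ℤ, Z 0 = z0 ∧ ∀ s, Z (s+1) = z' s :=
      ⟨fun s => Nat.casesOn s z0 z', rfl, fun _ => rfl⟩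
    refine ⟨Z, by rw [hZs, hz'd], by rw [hZ0]; exact hzB, by rw [hZ0]; exact hDz, ?_, ?_,
      by rw [hZ0]; exact hmin', by rw [hZ0]; exact hH, ?_⟩
    · rintro (_ | s) hs
      · rw [hZs, hZ0]; exact hz'1
      · rw [hZs, hZs]; exact hz'c s (by omega)
    · rintro (_ | s) hs
      · rw [hZs, hZ0]; exact S.nested hmin' hzB hz'H (by intro j; have := hz'D j; simp [D] at this ⊢; omega) hz'1
      · rw [hZs, hZs]; exact hz'E s (by omega)
    · intro x hxd hxB hxc
      have hcb := chain_bound hxc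
      set X : ℕ → ZMod f → ℤ := fun s => (x s + fun _ => (s:ℤ)) ⊔ z0 with hX
      set y : ℕ → ZMod f → ℤ := fun s => x s ⊓ (z0 - fun _ => (s:ℤ)) with hy
      have hx0D : D ≤ x 0 := by
        intro j
        have := hcb j (d+1) le_rfl
        rw [hxd] at this
        simpa [D] using this
      have hsub : ∀ s, S.F (y s) + S.F (X s - fun _ => (s:ℤ)) ≤ S.F (x s) + S.F (z0 - fun _ => (s:ℤ)) := by
        intro s
        have h := S.submod (x s) (z0 - fun _ => (s:ℤ))
        have h2 : X s - (fun _ => (s:ℤ)) = x s ⊔ (z0 - fun _ => (s:ℤ)) := by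
          ext j; simp [hX]; omega
        rw [h2]; exact h
      have hsum := Finset.sum_le_sum (s := range (d+1)) (fun s _ => hsub s)
      rw [Finset.sum_add_distrib, Finset.sum_add_distrib] at hsum
      have hXz : ∀ s < d + 1, z0 ≤ X s := fun s _ => le_sup_right
      have hXX : ∀ s < d + 1, X s ≤ X 0 := by
        intro s hs j
        have := hcb j s (by omega)
        simp [hX]; omega
      have hXB : X 0 ≤ B := by
        intro j
        have h1 : x 0 j ≤ B j := hxB j
        have h2 : z0 j ≤ B j := hzB j
        simp [hX]; omega
      have hy0 : S.F z0 ≤ S.F (y 0) := by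
        apply hmin'
        · intro j
          have h1 : D j ≤ x 0 j := hx0D j
          have h2 : D j ≤ z0 j := hDz j
          simp [hy]; omega
        · intro j
          have h2 : z0 j ≤ B j := hzB j
          simp [hy]; omega
      have hP := hz'opt (fun s => y (s+1)) (by
          ext j
          have h1 := hDz j
          have h2 := congrFun hxd j
          simp [hy, D] at h1 h2 ⊢; omega)
        (by intro j; simp [hy]) (by
          intro s hs j
          have := hxc (s+1) (by omega) j
          simp [hy] at this ⊢; omega)
      have e1 : ∑ s ∈ range (d+1), S.F (y s) = ∑ s ∈ range d, S.F (y (s+1)) + S.F (y 0) := sum_range_succ' _ _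
      have e2 : ∑ s ∈ range (d+1), S.F (Z s) = ∑ s ∈ range d, S.F (z' s) + S.F z0 := by
        rw [sum_range_succ', hZ0]; simp only [hZs]
      have hP1 := hP.1
      rw [e2, hZ0]
      by_cases hXne : X 0 = z0
      · have hxz : x 0 ≤ z0 := by
          intro j
          have := congrFun hXne j
          simp [hX] at this; exact this
        have hX' : ∀ s < d + 1, X s = z0 := fun s hs => le_antisymm ((hXX s hs).trans hXne.le) (hXz s hs)
        have h3 : ∑ s ∈ range (d+1), S.F (X s - fun _ => (s:ℤ)) = ∑ s ∈ range (d+1), S.F (z0 - fun _ => (s:ℤ)) := by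
          apply Finset.sum_congr rfl
          intro s hs; rw [hX' s (by simpa using hs)]
        have hyx : y 0 = x 0 := by
          ext j; have := hxz j; simp [hy]; omega
        rw [← hyx]
        refine ⟨by linarith, fun h _ => by linarith⟩
      · have := S.lemB hH d X hXz hXX hXB hXne
        refine ⟨by linarith, fun h _ => by linarith⟩

end
end Sheats
namespace Sheats
open Finset

/-- digits -/
def dig (p k j : ℕ) : ℕ := k / p ^ j % p

lemma dig_lt {p : ℕ} (hp : 2 ≤ p) (k j : ℕ) : dig p k j < p := Nat.mod_lt _ (by omega)

lemma sum_dig {p k : ℕ} (n : ℕ) : ∑ j ∈ range n, dig p k j * p ^ j = k % p ^ n := by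
  induction n with
  | zero => simp [Nat.mod_one]
  | succ n ih => rw [sum_range_succ, ih, Nat.mod_pow_succ, dig]; ring

lemma dig_sum {p : ℕ} (hp : 2 ≤ p) (n : ℕ) : ∀ (r : ℕ → ℕ), (∀ j, r j < p) → ∀ j,
    dig p (∑ i ∈ range n, r i * p ^ i) j = if j < n then r j else 0 := by
  induction n with
  | zero => intro r _ j; simp [dig]
  | succ n ih =>
    intro r hr j
    rw [sum_range_succ']
    have h1 : ∑ i ∈ range n, r (i+1) * p^(i+1) = p * ∑ i ∈ range n, r (i+1) * p^i := by
      rw [Finset.mul_sum]; apply Finset.sum_congr rfl; intro i _; ring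
    rw [h1]
    cases j with
    | zero =>
      simp [dig, Nat.mod_eq_of_lt (hr 0)]
    | succ j =>
      have h2 := ih (fun i => r (i+1)) (fun i => hr _) j
      simp only [dig] at h2 ⊢
      rw [pow_succ', ← Nat.div_div_eq_div_mul]
      have h3 : (p * ∑ i ∈ range n, r (i+1) * p^i + r 0 * p^0) / p = ∑ i ∈ range n, r (i+1) * p^i := by
        rw [pow_zero, mul_one, Nat.mul_add_div (by omega), Nat.div_eq_of_lt (hr 0)]; simp
      rw [h3, h2]
      simp

lemma dig_eq_zero {p k n j : ℕ} (hp : 2 ≤ p) (hk : k < p ^ n) (hj : n ≤ j) : dig p k j = 0 := by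
  unfold dig
  rw [Nat.div_eq_of_lt (lt_of_lt_of_le hk (Nat.pow_le_pow_right (by omega) hj))]; simp

section
variable {f : ℕ} [NeZero f]

lemma sum_ZMod_val {M : Type*} [AddCommMonoid M] (h : ℕ → M) :
    ∑ i : ZMod f, h i.val = ∑ j ∈ range f, h j := by
  cases f with
  | zero => exact absurd rfl (NeZero.ne 0)
  | succ n => exact Fin.sum_univ_eq_sum_range h (n+1)

lemma sum_pos {M : Type*} [AddCommMonoid M] (h : ℕ → M) (L : ℕ) :
    ∑ j ∈ range (f * L), h j = ∑ i : ZMod f, ∑ t ∈ range L, h (i.val + f * t) := by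
  induction L with
  | zero => simp
  | succ L ih =>
    rw [Nat.mul_succ, sum_range_add, ih]
    simp only [sum_range_succ, Finset.sum_add_distrib]
    congr 1
    rw [← sum_ZMod_val (fun j => h (f * L + j))]
    simp only [add_comm]

lemma natCast_pos (i : ZMod f) (t : ℕ) : ((i.val + f * t : ℕ) : ZMod f) = i := by
  simp

lemma div_pos' (i : ZMod f) (t : ℕ) : (i.val + f * t) / f = t := by
  rw [Nat.add_mul_div_left _ _ (Nat.pos_of_ne_zero (NeZero.ne f)), Nat.div_eq_of_lt (ZMod.val_lt i)]; simp

lemma val_succ_cases (e : ZMod f) : (e + 1 = 0 ∧ e.val + 1 = f ∧ (e+1).val = 0) ∨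
    (e + 1 ≠ 0 ∧ (e+1).val = e.val + 1) := by
  have h1 : e + 1 = ((e.val + 1 : ℕ) : ZMod f) := by simp
  have h2 : (e+1).val = (e.val + 1) % f := by
    conv_lhs => rw [h1, ZMod.val_natCast]
  have h3 := ZMod.val_lt e
  rcases Nat.eq_or_lt_of_le (Nat.succ_le_of_lt h3) with h | h
  · left
    have h4 : (e+1).val = 0 := by rw [h2, show e.val + 1 = f from h, Nat.mod_self]
    exact ⟨(ZMod.val_eq_zero _).1 h4, h, h4⟩
  · right
    have h4 : (e+1).val = e.val + 1 := by rw [h2, Nat.mod_eq_of_lt h]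
    refine ⟨?_, h4⟩
    intro h5
    rw [h5, ZMod.val_zero] at h4
    omega

lemma bracket (p : ℕ) (e : ZMod f) : (p:ℤ)^(e.val+1) - (p:ℤ)^((e+1).val) =
    if e + 1 = 0 then (p:ℤ)^f - 1 else 0 := by
  rcases val_succ_cases e with ⟨h1, h2, h3⟩ | ⟨h1, h2⟩
  · rw [if_pos h1, h2, h3]; simp
  · rw [if_neg h1, h2]; simp

/-- the carry vector of a multiset of digits divisible by `q - 1` -/
lemma exists_carry {p : ℕ} (hp : 2 ≤ p) (w : ZMod f → ℤ) (hw : ∀ i, 0 ≤ w i) (hw0 : ∃ i, 0 < w i)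
    (hdvd : ((p:ℤ)^f - 1) ∣ ∑ i : ZMod f, (p:ℤ)^(i.val) * w i) :
    ∃ y : ZMod f → ℤ, (∀ i, 1 ≤ y i) ∧ ∀ i, E p y i = w i := by
  have hp' : (2:ℤ) ≤ p := by exact_mod_cast hp
  have hf : 0 < f := Nat.pos_of_ne_zero (NeZero.ne f)
  have hq : 0 < (p:ℤ)^f - 1 := by
    have : (p:ℤ)^1 ≤ (p:ℤ)^f := pow_le_pow_right₀ (by omega) hf
    simp at this
    omega
  set l : ZMod f → ℤ := fun i => ∑ c : ZMod f, (p:ℤ)^((c - i).val) * w c with hl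
  have hrec : ∀ i, (p:ℤ) * l (i+1) - l i = ((p:ℤ)^f - 1) * w i := by
    intro i
    simp only [hl]
    rw [Finset.mul_sum, ← Finset.sum_sub_distrib, Finset.sum_eq_single i]
    · have := bracket p (i - (i+1))
      have e1 : i - (i+1) + 1 = 0 := by ring
      rw [e1, if_pos rfl, ZMod.val_zero] at this
      rw [sub_self, ZMod.val_zero, ← this]; ring
    · intro c _ hc
      have := bracket p (c - (i+1))
      have e1 : c - (i+1) + 1 = c - i := by ring
      rw [e1, if_neg (sub_ne_zero.2 hc)] at this
      have e2 : (p:ℤ) * ((p:ℤ) ^ (c - (i + 1)).val * w c) - (p:ℤ) ^ (c - i).val * w c =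
        ((p:ℤ)^((c - (i+1)).val + 1) - (p:ℤ)^((c-i).val)) * w c := by ring
      rw [e2, this, zero_mul]
    · simp
  have hcop : IsCoprime ((p:ℤ)^f - 1) (p:ℤ) := by
    refine ⟨-1, (p:ℤ)^(f-1), ?_⟩
    rw [← pow_succ, Nat.sub_add_cancel hf]; ring
  have hdl' : ∀ n : ℕ, ((p:ℤ)^f - 1) ∣ l (n : ZMod f) := by
    intro n
    induction n with
    | zero => simpa [hl] using hdvd
    | succ n ih =>
      push_cast
      apply hcop.dvd_of_dvd_mul_left
      have := hrec n
      have e : (p:ℤ) * l (n+1) = l n + ((p:ℤ)^f - 1) * w n := by linarith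
      rw [e]
      exact dvd_add ih (dvd_mul_right _ _)
  have hdl : ∀ i, ((p:ℤ)^f - 1) ∣ l i := by
    intro i; have := hdl' i.val; simpa using this
  choose y hy using hdl
  refine ⟨y, ?_, ?_⟩
  · intro i
    obtain ⟨c, hc⟩ := hw0
    have h1 : 0 < l i := by
      apply Finset.sum_pos'
      · intro j _; exact mul_nonneg (by positivity) (hw j)
      · exact ⟨c, mem_univ c, mul_pos (by positivity) hc⟩
    rw [hy] at h1
    have := pos_of_mul_pos_right h1 hq.le
    omega
  · intro i
    have := hrec i
    rw [hy, hy] at this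
    unfold E
    apply mul_left_cancel₀ hq.ne'
    linarith

end
end Sheats
namespace Sheats
open Finset
section
variable {f : ℕ} [NeZero f]

/-- digit multiplicities in class `i`, extended by `p - 1` -/
def mu (p : ℕ) (k L : ℕ) (i : ZMod f) (t : ℤ) : ℤ :=
  if 0 ≤ t ∧ t < L then (dig p k (i.val + f * t.toNat) : ℤ) else (p:ℤ) - 1

noncomputable def NN (p : ℕ) (k L : ℕ) (i : ZMod f) (t : ℤ) : ℤ :=
  ∑ s ∈ Ico 0 t, mu p k L i s - ∑ s ∈ Ico t 0, mu p k L i s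

variable {p : ℕ}

lemma mu_nonneg (hp : 2 ≤ p) (k L : ℕ) (i : ZMod f) (t : ℤ) : 0 ≤ mu p k L i t := by
  unfold mu; split_ifs <;> omega

lemma mu_le (hp : 2 ≤ p) (k L : ℕ) (i : ZMod f) (t : ℤ) : mu p k L i t ≤ p - 1 := by
  unfold mu; split_ifs
  · have := dig_lt hp k (i.val + f * t.toNat)
    omega
  · omega

lemma NN_zero (k L : ℕ) (i : ZMod f) : NN p k L i 0 = 0 := by simp [NN]

lemma NN_succ (k L : ℕ) (i : ZMod f) (t : ℤ) : NN p k L i (t+1) = NN p k L i t + mu p k L i t := by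
  unfold NN
  rcases le_or_gt 0 t with h | h
  · have e1 : Ico t 0 = ∅ := Ico_eq_empty_of_le h
    have e2 : Ico (t+1) 0 = ∅ := Ico_eq_empty_of_le (by omega)
    have e3 : Ico 0 (t+1) = insert t (Ico 0 t) := by ext; simp; omega
    rw [e1, e2, e3, sum_insert (by simp)]; simp; ring
  · have e1 : Ico 0 t = ∅ := Ico_eq_empty_of_le h.le
    have e2 : Ico 0 (t+1) = ∅ := Ico_eq_empty_of_le (by omega)
    have e3 : Ico t 0 = insert t (Ico (t+1) 0) := by ext; simp; omega
    rw [e1, e2, e3, sum_insert (by simp)]; simp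

lemma NN_mono (hp : 2 ≤ p) (k L : ℕ) (i : ZMod f) : Monotone (NN p k L i) := by
  apply monotone_int_of_le_succ
  intro t
  rw [NN_succ]
  have := mu_nonneg hp k L i t
  omega

lemma NN_neg (hp : 2 ≤ p) (k L : ℕ) (i : ZMod f) (t : ℕ) : NN p k L i (-t) ≤ -t := by
  induction t with
  | zero => simp [NN_zero]
  | succ t ih =>
    have h := NN_succ (p := p) k L i (-(t+1:ℕ))
    have h1 : mu p k L i (-(t+1:ℕ)) = p - 1 := by
      unfold mu; rw [if_neg]; push_cast; omega
    rw [h1] at h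
    have h2 : -((t+1:ℕ):ℤ) + 1 = -t := by push_cast; ring
    rw [h2] at h
    push_cast at h ⊢
    omega

lemma NN_large (hp : 2 ≤ p) (k L : ℕ) (i : ZMod f) (t : ℕ) : (t:ℤ) ≤ NN p k L i (L + t) := by
  induction t with
  | zero =>
    have := NN_mono hp k L i (show (0:ℤ) ≤ L + (0:ℕ) by positivity)
    rw [NN_zero] at this
    exact_mod_cast this
  | succ t ih =>
    have h := NN_succ (p := p) k L i (L + t)
    have h1 : mu p k L i (L + t) = p - 1 := by
      unfold mu; rw [if_neg]; omega
    rw [h1] at h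
    push_cast
    rw [← add_assoc]
    omega

lemma exists_T (hp : 2 ≤ p) (k L : ℕ) (i : ZMod f) (n : ℤ) : ∃ T : ℤ, ∀ t, T ≤ t ↔ n ≤ NN p k L i (t+1) := by
  obtain ⟨T, hT1, hT2⟩ := Int.exists_least_of_bdd (P := fun t => n ≤ NN p k L i (t+1))
    ⟨-n.natAbs - 3, fun t ht => by
      by_contra hcon
      have h1 := NN_mono hp k L i (show t + 1 ≤ -((n.natAbs + 1 : ℕ):ℤ) by omega)
      have h2 := NN_neg hp k L i (n.natAbs + 1)
      omega⟩
    ⟨L + n.natAbs, by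
      have h1 := NN_large hp k L i (n.natAbs)
      have h2 := NN_mono hp k L i (show (L + n.natAbs : ℤ) ≤ L + n.natAbs + 1 by omega)
      omega⟩
  refine ⟨T, fun t => ⟨fun h => ?_, hT2 t⟩⟩
  exact le_trans hT1 (NN_mono hp k L i (by omega))

noncomputable def TT (hp : 2 ≤ p) (k L : ℕ) (i : ZMod f) (n : ℤ) : ℤ := (exists_T hp k L i n).choose

lemma TT_le (hp : 2 ≤ p) (k L : ℕ) (i : ZMod f) {n t : ℤ} : TT hp k L i n ≤ t ↔ n ≤ NN p k L i (t+1) := (exists_T hp k L i n).choose_spec t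

lemma TT_eq (hp : 2 ≤ p) (k L : ℕ) (i : ZMod f) {n t : ℤ} : TT hp k L i n = t ↔ NN p k L i t < n ∧ n ≤ NN p k L i (t+1) := by
  have h1 := TT_le hp k L i (n := n) (t := t)
  have h2 := TT_le hp k L i (n := n) (t := t-1)
  rw [sub_add_cancel] at h2
  omega

noncomputable def mkSys (f : ℕ) [NeZero f] (hp : 2 ≤ p) (k L : ℕ) : Sys p f where
  hp := hp
  a := fun i n => i.val + f * TT hp k L i n
  mono := by
    intro i m n h
    have h1 : TT hp k L i m ≤ TT hp k L i n := by
      rw [TT_le]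
      exact le_trans h ((TT_le hp k L i).1 le_rfl)
    have : (f:ℤ) * TT hp k L i m ≤ f * TT hp k L i n := mul_le_mul_of_nonneg_left h1 (by positivity)
    simp only
    omega
  cls := by intro i n; simp
  step := by
    intro i n
    have h1 : TT hp k L i n + 1 ≤ TT hp k L i (n + ((p:ℤ)-1)) := by
      by_contra hcon
      have h2 : TT hp k L i (n + ((p:ℤ)-1)) ≤ TT hp k L i n := by omega
      rw [TT_le, NN_succ] at h2
      have h3 := mu_le hp k L i (TT hp k L i n)
      have h4 : TT hp k L i n ≤ TT hp k L i n - 1 := by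
        rw [TT_le, sub_add_cancel]; omega
      omega
    have : (f:ℤ) * (TT hp k L i n + 1) ≤ f * TT hp k L i (n + ((p:ℤ)-1)) := mul_le_mul_of_nonneg_left h1 (by positivity)
    linarith
  pos := by
    intro i n hn
    have h1 : 0 ≤ TT hp k L i n := by
      by_contra hcon
      have h2 : TT hp k L i n ≤ -1 := by omega
      rw [TT_le] at h2
      simp [NN_zero] at h2
      omega
    have : 0 ≤ (f:ℤ) * TT hp k L i n := by positivity
    omega
  neg := by
    intro i n hn
    have h1 : TT hp k L i n ≤ -1 := by
      rw [TT_le]; simpa [NN_zero] using hn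
    have hf : 0 < (f:ℤ) := by exact_mod_cast Nat.pos_of_ne_zero (NeZero.ne f)
    have : (f:ℤ) * TT hp k L i n < 0 := by nlinarith
    omega

/-- number of digits of the `w` lowest ones sitting in slot `t` -/
noncomputable def gg (p k L : ℕ) (i : ZMod f) (w : ℤ) (t : ℤ) : ℤ :=
  min w (NN p k L i (t+1)) - min w (NN p k L i t)

lemma gg_nonneg (hp : 2 ≤ p) (k L : ℕ) (i : ZMod f) (w t : ℤ) : 0 ≤ gg p k L i w t := by
  unfold gg
  have := NN_mono hp k L i (show t ≤ t + 1 by omega)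
  omega

lemma gg_le_mu (hp : 2 ≤ p) (k L : ℕ) (i : ZMod f) (w t : ℤ) : gg p k L i w t ≤ mu p k L i t := by
  unfold gg
  have := NN_succ (p := p) k L i t
  have := mu_nonneg hp k L i t
  omega

lemma gg_mono (hp : 2 ≤ p) (k L : ℕ) (i : ZMod f) {w w' : ℤ} (h : w ≤ w') (t : ℤ) : gg p k L i w t ≤ gg p k L i w' t := by
  unfold gg
  have := NN_mono hp k L i (show t ≤ t + 1 by omega)
  omega

lemma NN_L_nonneg (hp : 2 ≤ p) (k L : ℕ) (i : ZMod f) : 0 ≤ NN p k L i L := by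
  have := NN_mono hp k L i (show (0:ℤ) ≤ L by positivity)
  rwa [NN_zero] at this

lemma sum_gg (k L : ℕ) (i : ZMod f) {w : ℤ} (h0 : 0 ≤ w) (h1 : w ≤ NN p k L i L) :
    ∑ t ∈ range L, gg p k L i w t = w := by
  have := Finset.sum_range_sub (fun t : ℕ => min w (NN p k L i t)) L
  simp only [Nat.cast_add, Nat.cast_one] at this
  unfold gg
  rw [this, min_eq_left h1]
  simp [NN_zero, h0]

lemma C_eq (hp : 2 ≤ p) (k L : ℕ) (i : ZMod f) {w : ℤ} (h0 : 0 ≤ w) (h1 : w ≤ NN p k L i L) :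
    (mkSys f hp k L).C i w = ∑ t ∈ range L, (gg p k L i w t : ℝ) * (p:ℝ)^(i.val + f * t) := by
  induction w, h0 using Int.leInduction with
  | base =>
    have : ∀ t ∈ range L, (gg p k L i 0 t : ℝ) * (p:ℝ)^(i.val + f * t) = 0 := by
      intro t _
      have h2 := NN_mono hp k L i (show (0:ℤ) ≤ t by positivity)
      have h3 := NN_mono hp k L i (show (0:ℤ) ≤ t+1 by positivity)
      rw [NN_zero] at h2 h3
      simp [gg, h2, h3]
    rw [Finset.sum_eq_zero this]
    simp [Sys.C]
  | succ w hw ih =>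
    have h2 := (mkSys f hp k L).C_sub i (show w ≤ w + 1 by omega)
    have e1 : Ioc w (w+1) = {w+1} := by ext; simp; omega
    rw [e1, sum_singleton, ih (by omega)] at h2
    have hT0 : 0 ≤ TT hp k L i (w+1) := by
      by_contra hcon
      have h2 : TT hp k L i (w+1) ≤ -1 := by omega
      rw [TT_le] at h2
      simp [NN_zero] at h2
      omega
    have hTL : TT hp k L i (w+1) ≤ L - 1 := by
      rw [TT_le, sub_add_cancel]; exact h1
    obtain ⟨T, hT⟩ := Int.eq_ofNat_of_zero_le hT0
    have h3 : ∀ t : ℕ, gg p k L i (w+1) t = gg p k L i w t + if t = T then 1 else 0 := by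
      intro t
      have h4 := TT_eq hp k L i (n := w+1) (t := t)
      have h5 := NN_mono hp k L i (show (t:ℤ) ≤ t + 1 by omega)
      rw [hT] at h4
      unfold gg
      split_ifs with h
      · have := h4.1 (by omega); omega
      · have : ¬ (NN p k L i t < w + 1 ∧ w + 1 ≤ NN p k L i (t+1)) := fun h' => h (by have := h4.2 h'; omega)
        omega
    have h4 : (mkSys f hp k L).e i (w+1) = (p:ℝ)^(i.val + f * T) := by
      unfold Sys.e mkSys
      simp only
      rw [hT]
      norm_cast
    rw [h4] at h2
    have h5 : ∑ t ∈ range L, (gg p k L i (w+1) t : ℝ) * (p:ℝ)^(i.val + f * t) =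
      ∑ t ∈ range L, (gg p k L i w t : ℝ) * (p:ℝ)^(i.val + f * t) + (p:ℝ)^(i.val + f * T) := by
      simp only [h3]
      push_cast
      simp only [add_mul, Finset.sum_add_distrib, ite_mul, one_mul, zero_mul]
      congr 1
      rw [Finset.sum_ite_eq' (range L) T]
      rw [if_pos]
      rw [mem_range]; omega
    rw [h5]
    linarith

lemma C_le (hp : 2 ≤ p) (k L : ℕ) (i : ZMod f) {w : ℤ} (r : ℕ → ℤ) (hr0 : ∀ t, 0 ≤ r t) (hr : ∀ t < L, r t ≤ mu p k L i t)
    (hw : ∑ t ∈ range L, r t = w) :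
    0 ≤ w ∧ w ≤ NN p k L i L ∧
    (mkSys f hp k L).C i w ≤ ∑ t ∈ range L, (r t : ℝ) * (p:ℝ)^(i.val + f * t) := by
  have h0 : 0 ≤ w := by rw [← hw]; exact Finset.sum_nonneg fun t _ => hr0 t
  have h1 : w ≤ NN p k L i L := by
    have h2 : ∑ t ∈ range L, r t ≤ ∑ t ∈ range L, mu p k L i t :=
      Finset.sum_le_sum fun t ht => hr t (by simpa using ht)
    have := Finset.sum_range_sub (fun t : ℕ => (NN p k L i t)) L
    simp only [Nat.cast_add, Nat.cast_one, NN_succ, Nat.cast_zero, NN_zero, add_sub_cancel_left, sub_zero] at this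
    rw [this] at h2
    omega
  refine ⟨h0, h1, ?_⟩
  rw [C_eq hp k L i h0 h1]
  set T := TT hp k L i w with hT
  have hs := sum_gg (p := p) k L i h0 h1
  have hp1 : (1:ℝ) ≤ p := by exact_mod_cast (by omega : 1 ≤ p)
  rcases lt_or_ge T 0 with hT0 | hT0
  · have hw0 : w = 0 := by
      have : T ≤ -1 := by omega
      rw [hT, TT_le] at this
      simp [NN_zero] at this
      omega
    apply Finset.sum_le_sum
    intro t ht
    have h2 : gg p k L i w t = 0 := (Finset.sum_eq_zero_iff_of_nonneg (f := fun t : ℕ => gg p k L i w t) (fun t _ => gg_nonneg hp k L i w t)).1 (hs.trans hw0) t ht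
    rw [h2]
    have := hr0 t
    have : (0:ℝ) ≤ r t := by exact_mod_cast this
    simp; positivity
  obtain ⟨T', hT'⟩ := Int.eq_ofNat_of_zero_le hT0
  have key : ∀ t ∈ range L, 0 ≤ ((r t : ℝ) - gg p k L i w t) * ((p:ℝ)^(i.val + f * t) - (p:ℝ)^(i.val + f*T')) := by
    intro t ht
    have hTe := (TT_eq hp k L i (n := w) (t := T)).1 rfl
    rcases lt_trichotomy t T' with h | h | h
    · have h2 : r t ≤ gg p k L i w t := by
        have h3 := hr t (by simpa using ht)
        have h4 := NN_mono hp k L i (show (t:ℤ) + 1 ≤ T by omega)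
        have h5 := NN_mono hp k L i (show (t:ℤ) ≤ t + 1 by omega)
        have h6 := NN_succ (p := p) k L i t
        unfold gg; omega
      apply mul_nonneg_of_nonpos_of_nonpos
      · rw [sub_nonpos]; exact_mod_cast h2
      · rw [sub_nonpos]; apply pow_le_pow_right₀ hp1; gcongr
    · subst h; simp
    · have h2 : gg p k L i w t ≤ r t := by
        have h3 := hr0 t
        have h4 := NN_mono hp k L i (show T + 1 ≤ t by omega)
        have h5 := NN_mono hp k L i (show (t:ℤ) ≤ t + 1 by omega)
        unfold gg; omega
      apply mul_nonneg
      · rw [sub_nonneg]; exact_mod_cast h2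
      · rw [sub_nonneg]; apply pow_le_pow_right₀ hp1; gcongr
  have hk := Finset.sum_nonneg key
  have e1 : ∑ t ∈ range L, ((r t : ℝ) - gg p k L i w t) * ((p:ℝ)^(i.val + f * t) - (p:ℝ)^(i.val + f*T')) =
    ∑ t ∈ range L, (r t : ℝ) * (p:ℝ)^(i.val + f * t) - ∑ t ∈ range L, (gg p k L i w t : ℝ) * (p:ℝ)^(i.val + f * t)
     - (∑ t ∈ range L, (r t:ℝ) - ∑ t ∈ range L, (gg p k L i w t : ℝ)) * (p:ℝ)^(i.val + f*T') := by
    rw [← Finset.sum_sub_distrib, ← Finset.sum_sub_distrib, Finset.sum_mul, ← Finset.sum_sub_distrib]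
    apply Finset.sum_congr rfl; intro t _; ring
  have e2 : ∑ t ∈ range L, (r t:ℝ) = ∑ t ∈ range L, (gg p k L i w t : ℝ) := by
    exact_mod_cast hw.trans hs.symm
  rw [e1, e2] at hk
  linarith

/-- using digits beyond the available ones is expensive -/
lemma C_big (hp : 2 ≤ p) (k L : ℕ) (i : ZMod f) {w : ℤ} (h : NN p k L i L < w) : (p:ℝ)^(f * L) ≤ (mkSys f hp k L).C i w := by
  have h0 := NN_L_nonneg hp k L i
  have hp1 : (1:ℝ) ≤ p := by exact_mod_cast (by omega : 1 ≤ p)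
  unfold Sys.C
  rw [Ioc_eq_empty_of_le (show (0:ℤ) ≤ w by omega), sum_empty, sub_zero]
  refine le_trans ?_ (Finset.single_le_sum (f := fun n => (mkSys f hp k L).e i n) (a := w) (fun n _ => (Sys.e_pos _ _ _).le) (by simp; omega))
  have hT : (L:ℤ) ≤ TT hp k L i w := by
    by_contra hcon
    have : TT hp k L i w ≤ L - 1 := by omega
    rw [TT_le, sub_add_cancel] at this
    omega
  unfold Sys.e mkSys
  simp only
  rw [← zpow_natCast]
  apply zpow_le_zpow_right₀ hp1
  have : (f:ℤ) * L ≤ f * TT hp k L i w := mul_le_mul_of_nonneg_left hT (by positivity)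
  push_cast
  omega

lemma Sys.C_nonneg (S : Sys p f) (i : ZMod f) {w : ℤ} (h : 0 ≤ w) : 0 ≤ S.C i w := by
  unfold Sys.C
  rw [Ioc_eq_empty_of_le h, sum_empty, sub_zero]
  exact Finset.sum_nonneg fun n _ => (S.e_pos _ _).le

end
end Sheats
namespace Sheats
open Finset
section
variable {f : ℕ} [NeZero f] {p : ℕ}

structure InU (p q d k : ℕ) (M : ℕ → ℕ) : Prop where
  sum : ∑ l ∈ range (d+1), M l = k
  digs : ∀ j, ∑ l ∈ range (d+1), dig p (M l) j = dig p k j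
  ev : ∀ l, 1 ≤ l → l ≤ d → 0 < M l ∧ (q - 1) ∣ M l

def wtN (d : ℕ) (M : ℕ → ℕ) : ℕ := ∑ l ∈ range (d+1), (d - l) * M l

lemma wtN_add {p q d k : ℕ} {M : ℕ → ℕ} (h : InU p q d k M) :
    wtN d M + ∑ s ∈ range d, ∑ l ∈ Ioc s d, M l = d * k := by
  have h1 : ∑ s ∈ range d, ∑ l ∈ Ioc s d, M l = ∑ l ∈ range (d+1), ∑ s ∈ range l, M l := by
    apply Finset.sum_comm'
    intro s l; simp; omega
  rw [h1, wtN, ← Finset.sum_add_distrib, ← h.sum, Finset.mul_sum]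
  apply Finset.sum_congr rfl
  intro l hl
  simp only [sum_const, card_range, smul_eq_mul]
  rw [← add_mul]
  congr 1
  simp at hl; omega

lemma E_sum {ι : Type*} (A : Finset ι) (y : ι → ZMod f → ℤ) (i : ZMod f) :
    E p (∑ l ∈ A, y l) i = ∑ l ∈ A, E p (y l) i := by
  simp [E, Finset.sum_apply, Finset.mul_sum]

lemma mod_q (p : ℕ) (r : ℕ → ℤ) (L : ℕ) : ((p:ℤ)^f - 1) ∣ ∑ j ∈ range (f * L), r j * (p:ℤ)^j -
    ∑ i : ZMod f, (p:ℤ)^(i.val) * ∑ t ∈ range L, r (i.val + f * t) := by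
  rw [sum_pos, ← Finset.sum_sub_distrib]
  apply Finset.dvd_sum
  intro i _
  rw [Finset.mul_sum, ← Finset.sum_sub_distrib]
  apply Finset.dvd_sum
  intro t _
  have h : r (i.val + f * t) * (p:ℤ)^(i.val + f*t) - (p:ℤ)^(i.val) * r (i.val + f*t) =
    (((p:ℤ)^f)^t - 1) * ((p:ℤ)^(i.val) * r (i.val + f * t)) := by
    rw [pow_add, pow_mul]; ring
  rw [h]
  apply Dvd.dvd.mul_right
  simpa using sub_dvd_pow_sub_pow ((p:ℤ)^f) 1 t

lemma sum_bracket_dvd (y : ZMod f → ℤ) : ((p:ℤ)^f - 1) ∣ ∑ i : ZMod f, (p:ℤ)^(i.val) * E p y i := by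
  rw [sum_E_wt]
  apply Finset.dvd_sum
  intro i _
  rw [bracket]
  split_ifs <;> simp

lemma pf_cast (hp : 2 ≤ p) : ((p ^ f - 1 : ℕ) : ℤ) = (p:ℤ)^f - 1 := by
  rw [Nat.cast_sub (Nat.one_le_pow _ _ (by omega))]; simp

lemma mu_eq (k L : ℕ) (i : ZMod f) {t : ℕ} (ht : t < L) : mu p k L i t = dig p k (i.val + f * t) := by
  unfold mu; rw [if_pos (by omega)]; simp

lemma chain_of (hp : 2 ≤ p) {d k L : ℕ} (hk : k < p ^ (f * L)) {M : ℕ → ℕ} (hM : InU p (p^f) d k M) :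
    ∃ x : ℕ → ZMod f → ℤ, x d = 0 ∧ (∀ s < d, x (s+1) + 1 ≤ x s) ∧
      (∀ j, x 0 j ≤ ∑ j ∈ range (f * L), dig p k j) ∧
      ∀ s ≤ d, (mkSys f hp k L).F (x s) ≤ ∑ l ∈ Ioc s d, (M l : ℝ) := by
  have hp' : (2:ℤ) ≤ p := by exact_mod_cast hp
  have hMk : ∀ l ≤ d, M l < p ^ (f * L) := by
    intro l hl
    refine lt_of_le_of_lt ?_ hk
    rw [← hM.sum]
    exact Finset.single_le_sum (f := M) (fun _ _ => Nat.zero_le _) (by simp; omega)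
  have hMd : ∀ l ≤ d, M l = ∑ j ∈ range (f * L), dig p (M l) j * p ^ j := by
    intro l hl
    rw [sum_dig, Nat.mod_eq_of_lt (hMk l hl)]
  set W : ℕ → ZMod f → ℤ := fun l i => ∑ t ∈ range L, (dig p (M l) (i.val + f * t) : ℤ) with hW
  have hex : ∀ l, ∃ y : ZMod f → ℤ, 1 ≤ l → l ≤ d → (∀ i, 1 ≤ y i) ∧ ∀ i, E p y i = W l i := by
    intro l
    by_cases hl : 1 ≤ l ∧ l ≤ d
    · obtain ⟨hl1, hl2⟩ := hl
      obtain ⟨hpos, hdvd⟩ := hM.ev l hl1 hl2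
      have hWn : ∀ i, 0 ≤ W l i := fun i => Finset.sum_nonneg fun t _ => by positivity
      obtain ⟨y, hy⟩ := exists_carry hp (W l) hWn (by
        by_contra hcon
        push Not at hcon
        have hz : ∑ i, W l i = 0 := Finset.sum_eq_zero fun i _ => le_antisymm (hcon i) (hWn i)
        have h1 := sum_pos (f := f) (fun j => (dig p (M l) j : ℤ)) L
        simp only [hW] at hz
        rw [hz] at h1
        have h2 : ∑ j ∈ range (f*L), dig p (M l) j = 0 := by exact_mod_cast h1
        rw [Finset.sum_eq_zero_iff] at h2
        have h3 := hMd l hl2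
        rw [Finset.sum_eq_zero (fun j hj => by rw [h2 j hj, zero_mul])] at h3
        omega) (by
        have h1 := mod_q (f := f) p (fun j => (dig p (M l) j : ℤ)) L
        have h2 : ∑ j ∈ range (f * L), (dig p (M l) j : ℤ) * (p:ℤ)^j = M l := by
          conv_rhs => rw [hMd l hl2]
          push_cast; rfl
        rw [h2] at h1
        have h3 : ((p:ℤ)^f - 1) ∣ (M l : ℤ) := by
          rw [← pf_cast hp]; exact_mod_cast hdvd
        exact (dvd_sub_right h3).1 h1)
      exact ⟨y, fun _ _ => hy⟩
    · exact ⟨0, fun h1 h2 => absurd ⟨h1, h2⟩ hl⟩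
  choose y hy using hex
  have hIoc : ∀ s < d, Ioc s d = insert (s+1) (Ioc (s+1) d) := by
    intro s hs; ext; simp; omega
  have hEx : ∀ s i, E p (∑ l ∈ Ioc s d, y l) i = ∑ t ∈ range L, ((∑ l ∈ Ioc s d, dig p (M l) (i.val + f * t) : ℕ) : ℤ) := by
    intro s i
    rw [E_sum]
    push_cast
    rw [Finset.sum_comm]
    apply Finset.sum_congr rfl
    intro l hl
    simp at hl
    exact (hy l (by omega) (by omega)).2 i
  have hdle : ∀ s j, ∑ l ∈ Ioc s d, dig p (M l) j ≤ dig p k j := by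
    intro s j
    rw [← hM.digs j]
    apply Finset.sum_le_sum_of_subset
    intro l; simp; try omega
  refine ⟨fun s => ∑ l ∈ Ioc s d, y l, by simp, ?_, ?_, ?_⟩
  · intro s hs
    simp only
    rw [hIoc s hs, sum_insert (by simp), add_comm]
    intro i
    have := (hy (s+1) (by omega) (by omega)).1 i
    simp
    omega
  · have hnn : ∀ j, 0 ≤ (∑ l ∈ Ioc 0 d, y l) j := by
      intro j
      rw [Finset.sum_apply]
      apply Finset.sum_nonneg
      intro l hl
      simp at hl
      have := (hy l (by omega) (by omega)).1 j
      omega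
    intro j
    simp only
    have h1 := sum_E (p := p) (∑ l ∈ Ioc 0 d, y l)
    have h2 : ∑ i, E p (∑ l ∈ Ioc 0 d, y l) i ≤ ((∑ j ∈ range (f * L), dig p k j : ℕ):ℤ) := by
      rw [sum_pos]
      push_cast
      apply Finset.sum_le_sum
      intro i _
      rw [hEx]
      apply Finset.sum_le_sum
      intro t _
      exact_mod_cast hdle 0 _
    have h3 := Finset.single_le_sum (fun j _ => hnn j) (mem_univ j)
    push_cast at h2
    have h4 := Finset.sum_nonneg (fun j (_ : j ∈ univ) => hnn j)
    push_cast
    nlinarith [mul_nonneg (sub_nonneg.2 hp') h4]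
  · intro s hs
    have h1 : ∑ l ∈ Ioc s d, (M l : ℝ) = ∑ i : ZMod f, ∑ t ∈ range L, (((∑ l ∈ Ioc s d, dig p (M l) (i.val + f * t) : ℕ):ℤ) : ℝ) * (p:ℝ)^(i.val + f * t) := by
      rw [← sum_pos (fun j => (((∑ l ∈ Ioc s d, dig p (M l) j : ℕ):ℤ) : ℝ) * (p:ℝ)^j)]
      push_cast
      simp only [Finset.sum_mul]
      rw [Finset.sum_comm]
      apply Finset.sum_congr rfl
      intro l hl
      simp at hl
      conv_lhs => rw [hMd l (by omega)]
      push_cast; rfl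
    rw [h1]
    unfold Sys.F
    apply Finset.sum_le_sum
    intro i _
    refine (C_le hp k L i (fun t => ((∑ l ∈ Ioc s d, dig p (M l) (i.val + f * t) : ℕ):ℤ)) (fun t => by positivity) ?_ (hEx s i).symm).2.2
    intro t ht
    rw [mu_eq k L i ht]
    exact_mod_cast hdle s _

lemma tele {Γ : ℕ → ℕ} {n : ℕ} (h : ∀ l < n, Γ (l+1) ≤ Γ l) (a : ℕ) (ha : a ≤ n) :
    ∑ l ∈ Ico a n, (Γ l - Γ (l+1)) = Γ a - Γ n ∧ Γ n ≤ Γ a := by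
  induction n, ha using Nat.le_induction with
  | base => simp
  | succ n hn ih =>
    have h1 := ih (fun l hl => h l (by omega))
    have h2 := h n (by omega)
    rw [Finset.sum_Ico_succ_top hn, h1.1]
    omega

lemma U_of_chain (hp : 2 ≤ p) {d k L : ℕ} (hk : k < p ^ (f * L)) (z : ℕ → ZMod f → ℤ)
    (hzd : z d = 0) (hz1 : ∀ s < d, z (s+1) + 1 ≤ z s)
    (hzE : ∀ s < d, ∀ i, 0 ≤ E p (z s - z (s+1)) i) (hzK : ∀ i, E p (z 0) i ≤ NN p k L i L) :
    ∃ M, InU p (p^f) d k M ∧ ∀ s ≤ d, ∑ l ∈ Ioc s d, (M l : ℝ) = (mkSys f hp k L).F (z s) := by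
  have hp' : (2:ℤ) ≤ p := by exact_mod_cast hp
  have hstep : ∀ s < d, ∀ i, E p (z (s+1)) i ≤ E p (z s) i := by
    intro s hs i
    have := hzE s hs i
    rw [E_sub] at this; omega
  have hle : ∀ s ≤ d, ∀ i, E p (z s) i ≤ NN p k L i L := by
    intro s
    induction s with
    | zero => intro _; exact hzK
    | succ s ih => intro hs i; exact (hstep s (by omega) i).trans (ih (by omega) i)
  have hge : ∀ s ≤ d, ∀ i, 0 ≤ E p (z s) i := by
    intro s hs
    induction hs using Nat.decreasingInduction with
    | self => intro i; rw [hzd]; simp [E]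
    | of_succ s hs ih => intro i; exact (ih i).trans (hstep s hs i)
  set Γ : ℕ → ℕ → ℕ := fun l j => Nat.casesOn l (dig p k j)
    (fun s => (gg p k L (j : ZMod f) (E p (z s) j) ((j / f : ℕ):ℤ)).toNat) with hΓ
  have hΓ0 : ∀ j, Γ 0 j = dig p k j := fun j => rfl
  have hΓs : ∀ s (i : ZMod f) t, ((Γ (s+1) (i.val + f * t) : ℕ) : ℤ) = gg p k L i (E p (z s) i) t := by
    intro s i t
    change (((gg p k L ((i.val + f * t : ℕ) : ZMod f) (E p (z s) ((i.val + f * t : ℕ) : ZMod f)) (((i.val + f * t) / f : ℕ):ℤ)).toNat : ℕ) : ℤ) = _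
    rw [natCast_pos, div_pos', Int.toNat_of_nonneg (gg_nonneg hp k L i _ _)]
  have hpos_form : ∀ j, j < f * L → ∃ (i : ZMod f) (t : ℕ), t < L ∧ j = i.val + f * t := by
    intro j hj
    refine ⟨(j : ZMod f), j / f, Nat.div_lt_of_lt_mul hj, ?_⟩
    rw [ZMod.val_natCast, Nat.mod_add_div]
  have hΓlt : ∀ l j, Γ l j < p := by
    intro l j
    cases l with
    | zero => exact dig_lt hp k j
    | succ s =>
      change (gg p k L (j : ZMod f) (E p (z s) j) ((j / f : ℕ):ℤ)).toNat < p
      have h1 := gg_le_mu hp k L (j : ZMod f) (E p (z s) j) ((j / f : ℕ):ℤ)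
      have h2 := mu_le hp k L (j : ZMod f) ((j / f : ℕ):ℤ)
      omega
  have hΓd : ∀ j, j < f * L → Γ (d+1) j = 0 := by
    intro j hj
    obtain ⟨i, t, ht, rfl⟩ := hpos_form j hj
    have h1 := hΓs d i t
    have h2 := sum_gg (p := p) k L i (w := 0) le_rfl (NN_L_nonneg hp k L i)
    have h3 : E p (z d) i = 0 := by rw [hzd]; simp [E]
    rw [h3] at h1
    rw [Finset.sum_eq_zero_iff_of_nonneg (fun t _ => gg_nonneg hp k L i _ _)] at h2
    rw [h2 t (by simpa using ht)] at h1
    exact_mod_cast h1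
  have hΓa : ∀ j, j < f * L → ∀ l < d + 1, Γ (l+1) j ≤ Γ l j := by
    intro j hj l hl
    obtain ⟨i, t, ht, rfl⟩ := hpos_form j hj
    cases l with
    | zero =>
      have h1 := hΓs 0 i t
      have h2 := gg_le_mu hp k L i (E p (z 0) i) t
      rw [mu_eq k L i ht] at h2
      rw [hΓ0]
      omega
    | succ s =>
      have h1 := hΓs s i t
      have h2 := hΓs (s+1) i t
      have h3 := gg_mono hp k L i (hstep s (by omega) i) t
      omega
  set M : ℕ → ℕ := fun l => ∑ j ∈ range (f * L), (Γ l j - Γ (l+1) j) * p ^ j with hM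
  have hMsum : ∀ a ≤ d + 1, ∑ l ∈ Ico a (d+1), M l = ∑ j ∈ range (f * L), Γ a j * p ^ j := by
    intro a ha
    simp only [hM]
    rw [Finset.sum_comm]
    apply Finset.sum_congr rfl
    intro j hj
    have hj' : j < f * L := by simpa using hj
    rw [← Finset.sum_mul, (tele (Γ := fun l => Γ l j) (fun l hl => hΓa j hj' l hl) a ha).1, hΓd j hj']
    simp
  refine ⟨M, ⟨?_, ?_, ?_⟩, ?_⟩
  · have := hMsum 0 (by omega)
    rw [← Finset.range_eq_Ico] at this
    rw [this]
    simp only [hΓ0]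
    rw [sum_dig, Nat.mod_eq_of_lt hk]
  · intro j
    have h1 : ∀ l, dig p (M l) j = if j < f * L then Γ l j - Γ (l+1) j else 0 := by
      intro l
      exact dig_sum hp (f * L) (fun j => Γ l j - Γ (l+1) j) (fun j => lt_of_le_of_lt (Nat.sub_le _ _) (hΓlt l j)) j
    simp only [h1]
    split_ifs with hj
    · have := (tele (Γ := fun l => Γ l j) (fun l hl => hΓa j hj l hl) 0 (by omega)).1
      rw [← Finset.range_eq_Ico] at this
      rw [this, hΓd j hj, hΓ0]; simp
    · rw [dig_eq_zero hp hk (not_lt.1 hj)]; simp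
  · intro l hl1 hld
    obtain ⟨s, rfl⟩ : ∃ s, l = s + 1 := ⟨l - 1, by omega⟩
    set y := z s - z (s+1) with hy
    have hs : s < d := by omega
    have hsumr : ∀ i : ZMod f, ∑ t ∈ range L, ((Γ (s+1) (i.val + f * t) - Γ (s+1+1) (i.val + f*t) : ℕ) : ℤ) = E p y i := by
      intro i
      have h1 : ∀ t ∈ range L, ((Γ (s+1) (i.val + f * t) - Γ (s+1+1) (i.val + f*t) : ℕ) : ℤ) =
          gg p k L i (E p (z s) i) t - gg p k L i (E p (z (s+1)) i) t := by
        intro t ht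
        rw [← hΓs, ← hΓs, Nat.cast_sub]
        apply hΓa _ _ (s+1) (by omega)
        have h2 := ZMod.val_lt i
        have h3 : t < L := by simpa using ht
        have h4 : f * (t + 1) ≤ f * L := Nat.mul_le_mul_left _ h3
        rw [Nat.mul_succ] at h4
        omega
      rw [Finset.sum_congr rfl h1, Finset.sum_sub_distrib, sum_gg k L i (hge s (by omega) i) (hle s (by omega) i),
        sum_gg k L i (hge (s+1) (by omega) i) (hle (s+1) (by omega) i), hy, E_sub]
    constructor
    · rw [Nat.pos_iff_ne_zero]
      intro h0
      simp only [hM] at h0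
      rw [Finset.sum_eq_zero_iff] at h0
      have h1 : ∀ i, E p y i = 0 := by
        intro i
        rw [← hsumr]
        apply Finset.sum_eq_zero
        intro t ht
        have h2 := ZMod.val_lt i
        have h3 : t < L := by simpa using ht
        have h4 : f * (t + 1) ≤ f * L := Nat.mul_le_mul_left _ h3
        rw [Nat.mul_succ] at h4
        have h5 := h0 (i.val + f * t) (by simp; omega)
        rw [mul_eq_zero] at h5
        rcases h5 with h5 | h5
        · exact_mod_cast h5
        · exact absurd h5 (pow_ne_zero _ (by omega))
      have h2 := sum_E (p := p) y
      rw [Finset.sum_eq_zero (fun i _ => h1 i)] at h2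
      have h3 : 0 < ∑ i, y i := by
        apply Finset.sum_pos
        · intro i _
          have := hz1 s hs i
          simp [hy] at this ⊢; omega
        · exact ⟨0, mem_univ 0⟩
      have : 0 < ((p:ℤ) - 1) * ∑ i, y i := mul_pos (by omega) h3
      omega
    · have h1 := mod_q (f := f) p (fun j => ((Γ (s+1) j - Γ (s+1+1) j : ℕ) : ℤ)) L
      simp only [hsumr] at h1
      have h2 := (dvd_sub_left (sum_bracket_dvd y)).1 h1
      have h3 : ((p^f - 1 : ℕ) : ℤ) ∣ (M (s+1) : ℤ) := by
        rw [pf_cast hp]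
        simp only [hM]
        push_cast
        exact_mod_cast h2
      exact_mod_cast h3
  · intro s hs
    have h1 := hMsum (s+1) (by omega)
    have h2 : Ioc s d = Ico (s+1) (d+1) := by ext; simp; try omega
    rw [h2]
    have h3 : ∑ l ∈ Ico (s+1) (d+1), (M l : ℝ) = ((∑ j ∈ range (f * L), Γ (s+1) j * p ^ j : ℕ) : ℝ) := by
      rw [← h1]; push_cast; rfl
    rw [h3, sum_pos]
    push_cast
    unfold Sys.F
    apply Finset.sum_congr rfl
    intro i _
    rw [C_eq hp k L i (hge s hs i) (hle s hs i)]
    apply Finset.sum_congr rfl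
    intro t _
    have := hΓs s i t
    congr 1
    exact_mod_cast this

theorem ML (f : ℕ) [NeZero f] (hp : 2 ≤ p) (d k : ℕ) (hne : ∃ M, InU p (p^f) d k M) :
    ∃ Z, InU p (p^f) d k Z ∧ ∀ M, InU p (p^f) d k M → M 0 ≤ Z 0 ∧ wtN d M ≤ wtN d Z ∧
      (wtN d M = wtN d Z → M 0 = Z 0) := by
  have hf : 0 < f := Nat.pos_of_ne_zero (NeZero.ne f)
  obtain ⟨L, hk⟩ : ∃ L, k < p ^ (f * L) := by
    refine ⟨k, ?_⟩
    refine lt_of_lt_of_le (Nat.lt_pow_self (show 1 < p by omega)) ?_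
    apply Nat.pow_le_pow_right (by omega)
    nlinarith
  set S := mkSys f hp k L with hS
  set B : ZMod f → ℤ := fun _ => d + ∑ j ∈ range (f * L), (dig p k j : ℤ) with hB
  have hD0 : 0 ≤ ∑ j ∈ range (f * L), (dig p k j : ℤ) := Finset.sum_nonneg fun _ _ => by positivity
  obtain ⟨z, hzd, hzB, hzD, hz1, hzE, hzmin, -, hopt⟩ := S.core d B (by intro i; simp [hB]; exact_mod_cast hD0)
  have hdata : ∀ M, InU p (p^f) d k M → ∃ x : ℕ → ZMod f → ℤ, (∀ s ≤ d, S.F (x s) ≤ ∑ l ∈ Ioc s d, (M l : ℝ)) ∧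
      S.F (z 0) ≤ S.F (x 0) ∧ ∑ s ∈ range d, S.F (z s) ≤ ∑ s ∈ range d, S.F (x s) ∧
      (∑ s ∈ range d, S.F (x s) = ∑ s ∈ range d, S.F (z s) → 0 < d → S.F (x 0) = S.F (z 0)) := by
    intro M hM
    obtain ⟨x, hxd, hx1, hxb, hxF⟩ := chain_of hp hk hM
    have hxB : x 0 ≤ B := by
      intro i
      have := hxb i
      simp only [hB]
      push_cast at this
      omega
    refine ⟨x, hxF, hzmin _ ?_ hxB, hopt x hxd hxB hx1⟩
    intro i
    have := chain_bound hx1 i d le_rfl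
    rw [hxd] at this
    simpa using this
  have hge : ∀ i, 0 ≤ E p (z 0) i := by
    have : ∀ s ≤ d, ∀ i, 0 ≤ E p (z s) i := by
      intro s hs
      induction hs using Nat.decreasingInduction with
      | self => intro i; rw [hzd]; simp [E]
      | of_succ s hs ih =>
        intro i
        have h1 := ih i
        have h2 := hzE s hs i
        rw [E_sub] at h2; omega
    exact this 0 (by omega)
  have hsplit : ∀ M, InU p (p^f) d k M → M 0 + ∑ l ∈ Ioc 0 d, M l = k := by
    intro M hM
    rw [← hM.sum]
    have : range (d+1) = insert 0 (Ioc 0 d) := by ext; simp; try omega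
    rw [this, sum_insert (by simp)]
  have hzK : ∀ i, E p (z 0) i ≤ NN p k L i L := by
    intro i
    by_contra hcon
    push Not at hcon
    obtain ⟨M, hM⟩ := hne
    obtain ⟨x, hx1, hx2, -⟩ := hdata M hM
    have h1 := C_big hp k L i hcon
    have h2 : S.C i (E p (z 0) i) ≤ S.F (z 0) :=
      Finset.single_le_sum (f := fun i => S.C i (E p (z 0) i)) (fun j _ => S.C_nonneg j (hge j)) (mem_univ i)
    have h3 := hx1 0 (by omega)
    have h4 : ∑ l ∈ Ioc 0 d, (M l : ℝ) ≤ k := by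
      have := hsplit M hM
      exact_mod_cast (by omega : ∑ l ∈ Ioc 0 d, M l ≤ k)
    have h5 : (k:ℝ) < (p:ℝ)^(f*L) := by exact_mod_cast hk
    linarith
  obtain ⟨Z, hZ, hZF⟩ := U_of_chain hp hk z hzd hz1 hzE hzK
  refine ⟨Z, hZ, ?_⟩
  intro M hM
  obtain ⟨x, hx1, hx2, hx3, hx4⟩ := hdata M hM
  have hwM := wtN_add hM
  have hwZ := wtN_add hZ
  have hsM := hsplit M hM
  have hsZ := hsplit Z hZ
  have hM0 : ∑ l ∈ Ioc 0 d, Z l ≤ ∑ l ∈ Ioc 0 d, M l := by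
    have h1 := hx1 0 (by omega)
    have h2 := hZF 0 (by omega)
    have : ∑ l ∈ Ioc 0 d, (Z l : ℝ) ≤ ∑ l ∈ Ioc 0 d, (M l : ℝ) := by linarith
    exact_mod_cast this
  have hsum1 : ∑ s ∈ range d, S.F (x s) ≤ ∑ s ∈ range d, ∑ l ∈ Ioc s d, (M l : ℝ) :=
    Finset.sum_le_sum fun s hs => hx1 s (by simp at hs; omega)
  have hsum2 : ∑ s ∈ range d, ∑ l ∈ Ioc s d, (Z l : ℝ) = ∑ s ∈ range d, S.F (z s) :=
    Finset.sum_congr rfl fun s hs => hZF s (by simp at hs; omega)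
  refine ⟨by omega, ?_, ?_⟩
  · have : ∑ s ∈ range d, ∑ l ∈ Ioc s d, (Z l : ℝ) ≤ ∑ s ∈ range d, ∑ l ∈ Ioc s d, (M l : ℝ) := by linarith
    have : ∑ s ∈ range d, ∑ l ∈ Ioc s d, Z l ≤ ∑ s ∈ range d, ∑ l ∈ Ioc s d, M l := by exact_mod_cast this
    omega
  · intro heq
    have h1 : ∑ s ∈ range d, ∑ l ∈ Ioc s d, Z l = ∑ s ∈ range d, ∑ l ∈ Ioc s d, M l := by omega
    have h2 : ∑ s ∈ range d, ∑ l ∈ Ioc s d, (Z l : ℝ) = ∑ s ∈ range d, ∑ l ∈ Ioc s d, (M l : ℝ) := by exact_mod_cast h1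
    rcases Nat.eq_zero_or_pos d with hd | hd
    · subst hd
      simp at hsM hsZ
      omega
    have h3 := hx4 (by linarith) hd
    have h4 : ∑ s ∈ range d, S.F (x s) = ∑ s ∈ range d, ∑ l ∈ Ioc s d, (M l : ℝ) := by linarith
    have h5 := (Finset.sum_eq_sum_iff_of_le (fun s hs => hx1 s (by simp at hs; omega))).1 h4 0 (by simpa using hd)
    have h6 := hZF 0 (by omega)
    have h7 : ∑ l ∈ Ioc 0 d, (Z l : ℝ) = ∑ l ∈ Ioc 0 d, (M l : ℝ) := by linarith
    have h8 : ∑ l ∈ Ioc 0 d, Z l = ∑ l ∈ Ioc 0 d, M l := by exact_mod_cast h7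
    omega

end
end Sheats
namespace Sheats
open Finset

lemma dig_finsum {p : ℕ} (hp : 2 ≤ p) {ι : Type*} (A : Finset ι) (n : ι → ℕ) 
    (h : ∀ j, ∑ l ∈ A, dig p (n l) j < p) (j : ℕ) :
    dig p (∑ l ∈ A, n l) j = ∑ l ∈ A, dig p (n l) j := by
  set N := max (∑ l ∈ A, n l) j + 1 with hN
  have h1 : ∀ l ∈ A, n l = ∑ j ∈ range N, dig p (n l) j * p ^ j := by
    intro l hl
    rw [sum_dig, Nat.mod_eq_of_lt]
    have := Finset.single_le_sum (f := n) (fun _ _ => Nat.zero_le _) hl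
    have h2 : n l < N := by omega
    exact h2.trans (Nat.lt_pow_self (by omega))
  rw [Finset.sum_congr rfl h1, Finset.sum_comm]
  simp only [← Finset.sum_mul]
  rw [dig_sum hp N (fun j => ∑ l ∈ A, dig p (n l) j) h, if_pos (by omega)]

lemma InU.tail {p q d k : ℕ} (hp : 2 ≤ p) {M : ℕ → ℕ} (h : InU p q (d+1) k M) :
    InU p q d (k - M 0) (fun l => M (l+1)) := by
  have hs : ∑ l ∈ range (d+1), M (l+1) = k - M 0 := by
    have := h.sum
    rw [Finset.sum_range_succ'] at this
    omega
  refine ⟨hs, ?_, fun l h1 h2 => h.ev (l+1) (by omega) (by omega)⟩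
  intro j
  rw [← hs, dig_finsum hp]
  intro j
  have h1 := h.digs j
  rw [Finset.sum_range_succ'] at h1
  have := dig_lt hp k j
  omega

lemma InU.dig0 {p q d k : ℕ} (hp : 2 ≤ p) {M : ℕ → ℕ} (h : InU p q (d+1) k M) (j : ℕ) :
    dig p k j = dig p (M 0) j + dig p (k - M 0) j := by
  have h1 := h.digs j
  rw [Finset.sum_range_succ'] at h1
  rw [← (h.tail hp).digs j, ← h1, add_comm]

lemma InU.le0 {p q d k : ℕ} {M : ℕ → ℕ} (h : InU p q d k M) : M 0 ≤ k := by
  rw [← h.sum]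
  exact Finset.single_le_sum (f := M) (fun _ _ => Nat.zero_le _) (by simp)

lemma wtN_succ (d : ℕ) (M : ℕ → ℕ) : wtN (d+1) M = (d+1) * M 0 + wtN d (fun l => M (l+1)) := by
  unfold wtN
  rw [Finset.sum_range_succ', add_comm]
  simp

def LexN (d : ℕ) (M G : ℕ → ℕ) : Prop := ∃ i ≤ d, (∀ j < i, M j = G j) ∧ M i < G i

theorem greedyN {p : ℕ} (f : ℕ) [NeZero f] (hp : 2 ≤ p) (d : ℕ) : ∀ (k : ℕ) (G : ℕ → ℕ), InU p (p^f) d k G →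
    (∀ M, InU p (p^f) d k M → (∀ l ≤ d, M l = G l) ∨ LexN d M G) →
    ∀ M, InU p (p^f) d k M → (∀ l ≤ d, M l = G l) ∨ wtN d M < wtN d G := by
  induction d with
  | zero =>
    intro k G hG _ M hM
    left
    intro l hl
    have h1 := hG.sum
    have h2 := hM.sum
    simp at h1 h2
    obtain rfl : l = 0 := by omega
    omega
  | succ d ih =>
    intro k G hG hmax
    obtain ⟨Z, hZ, hZM⟩ := ML f hp (d+1) k ⟨G, hG⟩
    have hle0 : ∀ M, InU p (p^f) (d+1) k M → M 0 ≤ G 0 := by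
      intro M hM
      rcases hmax M hM with h | ⟨i, hi, hj, hlt⟩
      · exact (h 0 (by omega)).le
      · rcases Nat.eq_zero_or_pos i with rfl | h
        · exact hlt.le
        · exact (hj 0 h).le
    have hZ0 : Z 0 = G 0 := le_antisymm (hle0 Z hZ) (hZM G hG).1
    have hGk := hG.le0
    have htail : ∀ N, InU p (p^f) d (k - G 0) N → (∀ l ≤ d, N l = G (l+1)) ∨ LexN d N (fun l => G (l+1)) := by
      intro N hN
      rcases Nat.eq_zero_or_pos (N 0) with h0 | h0
      · right
        refine ⟨0, by omega, by simp, ?_⟩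
        have := (hG.ev 1 (by omega) (by omega)).1
        simpa [h0] using this
      · have hdv : (p^f - 1) ∣ N 0 := by
          have h1 : (p^f - 1) ∣ k - G 0 := by
            rw [← (hG.tail hp).sum]
            apply Finset.dvd_sum
            intro l hl
            simp at hl
            exact (hG.ev (l+1) (by omega) (by omega)).2
          rw [← hN.sum, Finset.sum_range_succ'] at h1
          refine (Nat.dvd_add_right ?_).1 h1
          apply Finset.dvd_sum
          intro l hl
          simp at hl
          exact (hN.ev (l+1) (by omega) (by omega)).2
        set M : ℕ → ℕ := fun l => Nat.casesOn l (G 0) N with hMdef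
        have hM0 : M 0 = G 0 := rfl
        have hMs : ∀ l, M (l+1) = N l := fun l => rfl
        have hM : InU p (p^f) (d+1) k M := by
          refine ⟨?_, ?_, ?_⟩
          · rw [Finset.sum_range_succ']
            simp only [hMs, hM0]
            rw [hN.sum]; omega
          · intro j
            rw [Finset.sum_range_succ']
            simp only [hMs, hM0]
            rw [hN.digs, hG.dig0 hp j, add_comm]
          · intro l h1 h2
            obtain ⟨s, rfl⟩ : ∃ s, l = s + 1 := ⟨l - 1, by omega⟩
            rw [hMs]
            rcases Nat.eq_zero_or_pos s with rfl | hs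
            · exact ⟨h0, hdv⟩
            · exact hN.ev s hs (by omega)
        rcases hmax M hM with h | ⟨i, hi, hj, hlt⟩
        · left
          intro l hl
          exact h (l+1) (by omega)
        · right
          cases i with
          | zero => rw [hM0] at hlt; omega
          | succ i => exact ⟨i, by omega, fun j hji => hj (j+1) (by omega), hlt⟩
    have key : ∀ M, InU p (p^f) (d+1) k M → M 0 = G 0 → (∀ l ≤ d + 1, M l = G l) ∨ wtN (d+1) M < wtN (d+1) G := by
      intro M hM h0
      have hMt := hM.tail hp
      rw [h0] at hMt
      rcases ih (k - G 0) (fun l => G (l+1)) (hG.tail hp) htail _ hMt with h | h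
      · left
        intro l hl
        cases l with
        | zero => exact h0
        | succ l => exact h l (by omega)
      · right
        rw [wtN_succ, wtN_succ, h0]
        omega
    intro M hM
    by_cases h0 : M 0 = G 0
    · exact key M hM h0
    · right
      obtain ⟨h1, h2, h3⟩ := hZM M hM
      have h4 : wtN (d+1) M < wtN (d+1) Z := lt_of_le_of_ne h2 (fun h => h0 ((h3 h).trans hZ0))
      rcases key Z hZ hZ0 with h | h
      · have : wtN (d+1) Z = wtN (d+1) G := by
          unfold wtN
          apply Finset.sum_congr rfl
          intro l hl
          simp at hl
          rw [h l (by omega)]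
        omega
      · omega

def ext {d : ℕ} (m : Fin (d+1) → ℕ) : ℕ → ℕ := fun l => if h : l < d + 1 then m ⟨l, h⟩ else 0

lemma ext_val {d : ℕ} (m : Fin (d+1) → ℕ) (i : Fin (d+1)) : ext m i = m i := by
  simp only [ext, dif_pos i.2]

lemma mem_Uset {p q d k : ℕ} (m : Fin (d+1) → ℕ) : m ∈ Uset p q d k ↔ InU p q d k (ext m) := by
  constructor
  · rintro ⟨⟨h1, h2⟩, h3⟩
    refine ⟨?_, ?_, ?_⟩
    · rw [Finset.sum_range]; simpa only [ext_val] using h1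
    · intro j; rw [Finset.sum_range]; simpa only [ext_val, dig] using h2 j
    · intro l hl hld
      have := h3 ⟨l, by omega⟩ hl
      rwa [← ext_val m] at this
  · rintro ⟨h1, h2, h3⟩
    refine ⟨⟨?_, ?_⟩, ?_⟩
    · rw [Finset.sum_range] at h1; simpa only [ext_val] using h1
    · intro j; have := h2 j; rw [Finset.sum_range] at this; simpa only [ext_val, dig] using this
    · intro i hi
      have := h3 i hi (by omega)
      rwa [ext_val] at this

lemma wtU_eq {d : ℕ} (m : Fin (d+1) → ℕ) : wtU m = wtN d (ext m) := by
  unfold wtU wtN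
  rw [Finset.sum_range]
  simp only [ext_val]

theorem greedyU {p : ℕ} (f : ℕ) [NeZero f] (hp : 2 ≤ p) (d k : ℕ) (G : Fin (d+1) → ℕ)
    (hG : G ∈ Uset p (p^f) d k) (hmax : ∀ m ∈ Uset p (p ^ f) d k, LexLE m G) :
    ∀ m ∈ Uset p (p ^ f) d k, m ≠ G → wtU m < wtU G := by
  intro m hm hne
  rw [wtU_eq, wtU_eq]
  have := greedyN f hp d k (ext G) ((mem_Uset G).1 hG) ?_ (ext m) ((mem_Uset m).1 hm)
  · rcases this with h | h
    · exfalso; apply hne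
      funext i
      have := h i (by omega)
      rwa [ext_val, ext_val] at this
    · exact h
  · intro M hM
    set m' : Fin (d+1) → ℕ := fun i => M i with hm'
    have he : ∀ l ≤ d, ext m' l = M l := by
      intro l hl
      simp [ext, hm']; omega
    have hm'U : m' ∈ Uset p (p^f) d k := by
      rw [mem_Uset]
      refine ⟨?_, ?_, ?_⟩
      · rw [← hM.sum]
        exact Finset.sum_congr rfl fun l hl => he l (by simp at hl; omega)
      · intro j
        rw [← hM.digs j]
        exact Finset.sum_congr rfl fun l hl => by rw [he l (by simp at hl; omega)]
      · intro l h1 h2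
        rw [he l h2]; exact hM.ev l h1 h2
    rcases hmax m' hm'U with h | ⟨i, hj, hlt⟩
    · left
      intro l hl
      rw [← he l hl, h]
    · right
      refine ⟨i, by omega, ?_, ?_⟩
      · intro j hji
        have := hj ⟨j, by omega⟩ hji
        rw [← ext_val G] at this
        exact this
      · rw [ext_val]; exact hlt
end Sheats
namespace Sheats
open Finset

lemma sum_pow_all {Fq : Type} [Field Fq] [Fintype Fq] (m : ℕ) :
    ∑ x : Fq, x ^ m = if 0 < m ∧ (Fintype.card Fq - 1) ∣ m then -1 else 0 := by
  classical
  rcases Nat.eq_zero_or_pos m with rfl | hm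
  · simp
  · have h := FiniteField.sum_pow_units Fq m
    simp only [hm, true_and]
    rw [← h]
    rw [← Finset.sum_subset (Finset.subset_univ (univ \ {(0:Fq)}))]
    · symm
      refine Finset.sum_bij (fun (u : Fqˣ) _ => (u:Fq)) ?_ ?_ ?_ ?_
      · intro a _; simp
      · intro a _ b _ h; exact Units.ext h
      · intro b hb
        simp at hb
        exact ⟨Units.mk0 b hb, mem_univ _, rfl⟩
      · intro a _; simp
    · intro x _ hx
      simp at hx
      rw [hx, zero_pow (by omega)]

lemma powerSum_zero (Fq : Type) [Field Fq] [Fintype Fq] (k : ℕ) : powerSum Fq 0 k = 1 := by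
  simp [powerSum]

lemma powerSum_succ (Fq : Type) [Field Fq] [Fintype Fq] (d k : ℕ) :
    powerSum Fq (d+1) k = ∑ m ∈ (range (k+1)).filter (fun m => 0 < m ∧ (Fintype.card Fq - 1) ∣ m),
      C (-(k.choose m : Fq)) * X ^ (k - m) * powerSum Fq d (k - m) := by
  unfold powerSum
  rw [← (Fin.consEquiv (fun _ : Fin (d+1) => Fq)).sum_comp, Fintype.sum_prod_type]
  have h1 : ∀ (x : Fq) (y : Fin d → Fq), (X ^ (d+1) + ∑ i : Fin (d+1), C ((Fin.consEquiv (fun _ : Fin (d+1) => Fq)) (x, y) i) * X ^ (i:ℕ) : Fq[X]) ^ k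
      = ∑ m ∈ range (k+1), C (x^m * (k.choose m : Fq)) * X ^ (k-m) * (X ^ d + ∑ i : Fin d, C (y i) * X ^ (i:ℕ)) ^ (k - m) := by
    intro x y
    have : (X ^ (d+1) + ∑ i : Fin (d+1), C ((Fin.consEquiv (fun _ : Fin (d+1) => Fq)) (x, y) i) * X ^ (i:ℕ) : Fq[X])
      = C x + X * (X ^ d + ∑ i : Fin d, C (y i) * X ^ (i:ℕ)) := by
      rw [Fin.sum_univ_succ]
      simp only [Fin.consEquiv, Equiv.coe_fn_mk, Fin.cons_zero, Fin.cons_succ, Fin.val_zero, Fin.val_succ, pow_zero, mul_one, pow_succ, mul_add, Finset.mul_sum]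
      have : ∀ i : Fin d, C (y i) * (X ^ (i:ℕ) * X) = (X * (C (y i) * X ^ (i:ℕ)) : Fq[X]) := fun i => by ring
      simp only [this]
      ring
    rw [this, add_pow]
    apply Finset.sum_congr rfl
    intro m _
    rw [mul_pow, C_mul, C_pow, C_eq_natCast]
    ring
  simp only [h1]
  have h2 : ∀ x : Fq, ∑ y : Fin d → Fq, ∑ m ∈ range (k+1), C (x^m * (k.choose m : Fq)) * X ^ (k-m) * (X ^ d + ∑ i : Fin d, C (y i) * X ^ (i:ℕ)) ^ (k - m)
     = ∑ m ∈ range (k+1), C (x^m) * (C (k.choose m : Fq) * X ^ (k-m) * ∑ y : Fin d → Fq, (X ^ d + ∑ i : Fin d, C (y i) * X ^ (i:ℕ)) ^ (k - m)) := by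
    intro x
    rw [Finset.sum_comm]
    apply Finset.sum_congr rfl
    intro m _
    rw [Finset.mul_sum, Finset.mul_sum]
    apply Finset.sum_congr rfl
    intro y _
    rw [C_mul]; ring
  simp only [h2]
  rw [Finset.sum_comm, Finset.sum_filter]
  apply Finset.sum_congr rfl
  intro m _
  rw [← Finset.sum_mul, ← map_sum, sum_pow_all]
  split_ifs
  · simp
  · simp

lemma choose_ne_zero {p : ℕ} (hp : p.Prime) (k m : ℕ) : ¬ p ∣ k.choose m ↔ ∀ j, dig p m j ≤ dig p k j := by
  haveI := Fact.mk hp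
  set a := max k m
  have hk : k < p ^ a := lt_of_le_of_lt (le_max_left k m) (Nat.lt_pow_self hp.one_lt)
  have hm : m < p ^ a := lt_of_le_of_lt (le_max_right k m) (Nat.lt_pow_self hp.one_lt)
  have h := Choose.choose_modEq_prod_range_choose_nat hk hm
  rw [h.dvd_iff dvd_rfl, hp.prime.dvd_finset_prod_iff]
  push Not
  have key : ∀ j, ¬ p ∣ (k / p^j % p).choose (m / p^j % p) ↔ dig p m j ≤ dig p k j := by
    intro j
    unfold dig
    constructor
    · intro h1
      by_contra h2
      rw [Nat.choose_eq_zero_of_lt (by omega)] at h1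
      simp at h1
    · intro h1 h2
      have h3 := h2.mul_right ((m / p^j % p).factorial * (k / p^j % p - m / p^j % p).factorial)
      rw [← mul_assoc, Nat.choose_mul_factorial_mul_factorial h1, hp.dvd_factorial] at h3
      have := Nat.mod_lt (k / p^j) hp.pos
      omega
  constructor
  · intro h1 j
    by_cases hj : j < a
    · exact (key j).1 (h1 j (by simpa using hj))
    · rw [dig_eq_zero hp.two_le hm (by omega)]; omega
  · intro h1 j _
    exact (key j).2 (h1 j)

lemma dig_sub {p : ℕ} (hp : 2 ≤ p) {k m : ℕ} (h : ∀ j, dig p m j ≤ dig p k j) :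
    m ≤ k ∧ ∀ j, dig p (k - m) j + dig p m j = dig p k j := by
  set a := max k m
  have hk : k < p ^ a := lt_of_le_of_lt (le_max_left k m) (Nat.lt_pow_self (by omega))
  have hm : m < p ^ a := lt_of_le_of_lt (le_max_right k m) (Nat.lt_pow_self (by omega))
  have h1 : k = m + ∑ j ∈ range a, (dig p k j - dig p m j) * p ^ j := by
    have e1 := sum_dig (p := p) (k := k) a
    have e2 := sum_dig (p := p) (k := m) a
    rw [Nat.mod_eq_of_lt hk] at e1
    rw [Nat.mod_eq_of_lt hm] at e2
    conv_lhs => rw [← e1]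
    conv_rhs => rw [← e2]
    rw [← Finset.sum_add_distrib]
    apply Finset.sum_congr rfl
    intro j _
    rw [← add_mul, sum_dig, Nat.mod_eq_of_lt hm]
    have := h j
    congr 1; omega
  refine ⟨by omega, ?_⟩
  intro j
  have h2 : k - m = ∑ j ∈ range a, (dig p k j - dig p m j) * p ^ j := by omega
  rw [h2, dig_sum hp a _ (fun j => lt_of_le_of_lt (Nat.sub_le _ _) (dig_lt hp k j))]
  split_ifs with hj
  · have := h j; omega
  · rw [dig_eq_zero hp hk (by omega), dig_eq_zero hp hm (by omega)]

lemma snoc_mem {p q d k : ℕ} (hp : 2 ≤ p) (m' : Fin (d+1) → ℕ) (m : ℕ) :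
    (Fin.snoc m' m : Fin (d+2) → ℕ) ∈ Uset p q (d+1) k ↔
      (m ≤ k ∧ (0 < m ∧ (q-1) ∣ m) ∧ ∀ j, dig p m j ≤ dig p k j) ∧ m' ∈ Uset p q d (k - m) := by
  unfold Uset NoCarry
  simp only [Set.mem_setOf_eq]
  rw [Fin.sum_univ_castSucc]
  simp only [Fin.sum_univ_castSucc (n := d+1), Fin.forall_fin_succ' (n := d+1), Fin.snoc_castSucc, Fin.snoc_last, Fin.val_castSucc, Fin.val_last]
  change ((_ ∧ ∀ j, ∑ i, dig p (m' i) j + dig p m j = dig p k j) ∧ _) ↔ _ ∧ ((_ ∧ ∀ j, ∑ i, dig p (m' i) j = dig p (k-m) j) ∧ _)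
  constructor
  · rintro ⟨⟨h1, h2⟩, h3, h4⟩
    have h5 : ∀ j, dig p m j ≤ dig p k j := fun j => by have := h2 j; omega
    refine ⟨⟨by omega, h4 (by omega), h5⟩, ⟨by omega, ?_⟩, h3⟩
    intro j
    have := (dig_sub hp h5).2 j
    have := h2 j
    omega
  · rintro ⟨⟨h1, h2, h3⟩, ⟨h4, h5⟩, h6⟩
    refine ⟨⟨by omega, ?_⟩, h6, fun _ => h2⟩
    intro j
    rw [h5, (dig_sub hp h3).2]

lemma wt_snoc {d : ℕ} (m' : Fin (d+1) → ℕ) (m : ℕ) :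
    wtU (Fin.snoc m' m : Fin (d+2) → ℕ) = ∑ i, m' i + wtU m' := by
  unfold wtU
  rw [Fin.sum_univ_castSucc (n := d+1), ← Finset.sum_add_distrib]
  simp only [Fin.snoc_castSucc, Fin.snoc_last, Fin.val_castSucc, Fin.val_last]
  rw [Nat.sub_self, zero_mul, add_zero]
  apply Finset.sum_congr rfl
  intro i _
  have : d + 1 - (i:ℕ) = 1 + (d - i) := by omega
  rw [this, add_mul, one_mul]

open Classical in
noncomputable def UF (p q d k : ℕ) : Finset (Fin (d+1) → ℕ) :=
  (Fintype.piFinset fun _ => range (k+1)).filter (· ∈ Uset p q d k)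

lemma mem_UF {p q d k : ℕ} (m : Fin (d+1) → ℕ) : m ∈ UF p q d k ↔ m ∈ Uset p q d k := by
  classical
  unfold UF
  rw [Finset.mem_filter]
  refine ⟨fun h => h.2, fun h => ⟨?_, h⟩⟩
  rw [Fintype.mem_piFinset]
  intro i
  have h1 := Finset.single_le_sum (f := m) (fun _ _ => Nat.zero_le _) (mem_univ i)
  rw [h.1.1] at h1
  simp; omega

theorem powerSum_eq {p f : ℕ} (hp : p.Prime) (Fq : Type) [Field Fq] [Fintype Fq]
    (hcard : Fintype.card Fq = p ^ f) (d : ℕ) : ∀ k, ∃ c : (Fin (d+1) → ℕ) → Fq,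
      (∀ m ∈ UF p (p^f) d k, c m ≠ 0) ∧ powerSum Fq d k = ∑ m ∈ UF p (p^f) d k, C (c m) * X ^ (wtU m) := by
  classical
  haveI := Fact.mk hp
  haveI : CharP Fq p := charP_of_card_eq_prime_pow hcard
  have hcast : ∀ n : ℕ, (n : Fq) = 0 ↔ p ∣ n := fun n => CharP.cast_eq_zero_iff Fq p n
  induction d with
  | zero =>
    intro k
    refine ⟨fun _ => 1, fun _ _ => one_ne_zero, ?_⟩
    have : UF p (p^f) 0 k = {fun _ => k} := by
      ext m
      rw [mem_UF, Finset.mem_singleton]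
      unfold Uset NoCarry
      simp only [Set.mem_setOf_eq]
      constructor
      · intro h
        funext i
        have h1 := h.1.1
        rw [Fin.sum_univ_succ, Fin.sum_univ_zero] at h1
        have h2 : i = 0 := Fin.ext (by simp)
        rw [h2]
        simpa using h1
      · rintro rfl
        refine ⟨⟨by simp, by simp⟩, ?_⟩
        intro i hi
        omega
    rw [this, powerSum_zero]
    simp [wtU]
  | succ d ih =>
    intro k
    choose c hc0 hc using ih
    refine ⟨fun M => -(k.choose (M (Fin.last (d+1))) : Fq) * c (k - M (Fin.last (d+1))) (Fin.init M), ?_, ?_⟩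
    · intro M hM
      rw [mem_UF, ← Fin.snoc_init_self M, snoc_mem hp.two_le] at hM
      apply mul_ne_zero
      · rw [neg_ne_zero, Ne, hcast, choose_ne_zero hp]
        exact hM.1.2.2
      · exact hc0 _ _ ((mem_UF _).2 hM.2)
    · rw [powerSum_succ, hcard]
      have h1 : ∑ m ∈ (range (k+1)).filter (fun m => 0 < m ∧ (p^f - 1) ∣ m),
          C (-(k.choose m : Fq)) * X ^ (k - m) * powerSum Fq d (k - m) = 
          ∑ m ∈ (range (k+1)).filter (fun m => (0 < m ∧ (p^f - 1) ∣ m) ∧ ∀ j, dig p m j ≤ dig p k j),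
          C (-(k.choose m : Fq)) * X ^ (k - m) * powerSum Fq d (k - m) := by
        symm
        apply Finset.sum_subset
        · intro m hm
          simp only [Finset.mem_filter] at hm ⊢
          exact ⟨hm.1, hm.2.1⟩
        · intro m hm hm2
          simp only [Finset.mem_filter] at hm hm2
          have : ¬ ∀ j, dig p m j ≤ dig p k j := fun h => hm2 ⟨hm.1, hm.2, h⟩
          rw [← choose_ne_zero hp, not_not, ← hcast] at this
          rw [this]; simp
      rw [h1]
      have h2 : ∀ m, C (-(k.choose m : Fq)) * X ^ (k - m) * powerSum Fq d (k - m) =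
          ∑ m' ∈ UF p (p^f) d (k-m), C (-(k.choose m : Fq) * c (k-m) m') * X ^ (wtU (Fin.snoc m' m : Fin (d+2) → ℕ)) := by
        intro m
        rw [hc, Finset.mul_sum]
        apply Finset.sum_congr rfl
        intro m' hm'
        rw [mem_UF] at hm'
        rw [wt_snoc, hm'.1.1, C_mul, pow_add]
        ring
      simp only [h2]
      rw [Finset.sum_sigma']
      refine Finset.sum_bij' (fun a _ => (Fin.snoc a.2 a.1 : Fin (d+2) → ℕ)) (fun M _ => ⟨M (Fin.last (d+1)), Fin.init M⟩) ?_ ?_ ?_ ?_ ?_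
      · rintro ⟨m, m'⟩ ha
        simp only [Finset.mem_sigma, Finset.mem_filter, mem_UF, Finset.mem_range] at ha ⊢
        rw [snoc_mem hp.two_le]
        exact ⟨⟨by omega, ha.1.2⟩, ha.2⟩
      · intro M hM
        rw [mem_UF, ← Fin.snoc_init_self M, snoc_mem hp.two_le] at hM
        simp only [Finset.mem_sigma, Finset.mem_filter, mem_UF, Finset.mem_range]
        exact ⟨⟨by omega, hM.1.2⟩, hM.2⟩
      · rintro ⟨m, m'⟩ ha
        simp
      · intro M hM
        simp
      · rintro ⟨m, m'⟩ ha
        simp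

lemma lex_total {n : ℕ} (x y : Fin n → ℕ) : LexLE x y ∨ LexLT y x := by
  classical
  by_cases h : x = y
  · exact Or.inl (Or.inl h)
  · have hex : ∃ i, x i ≠ y i := by
      by_contra hcon
      push Not at hcon
      exact h (funext hcon)
    obtain ⟨i, hi, hmin⟩ := WellFounded.has_min (wellFounded_lt (α := Fin n)) {i | x i ≠ y i} hex
    have heq : ∀ j < i, x j = y j := by
      intro j hj
      by_contra hcon
      exact hmin j hcon hj
    rcases lt_or_gt_of_ne hi with h1 | h1
    · exact Or.inl (Or.inr ⟨i, heq, h1⟩)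
    · exact Or.inr ⟨i, fun j hj => (heq j hj).symm, h1⟩

lemma lexLT_trans {n : ℕ} {x y z : Fin n → ℕ} (h1 : LexLT x y) (h2 : LexLT y z) : LexLT x z := by
  obtain ⟨i, hi, hi2⟩ := h1
  obtain ⟨j, hj, hj2⟩ := h2
  rcases lt_trichotomy i j with h | h | h
  · exact ⟨i, fun l hl => (hi l hl).trans (hj l (hl.trans h)), by rw [← hj i h]; exact hi2⟩
  · subst h
    exact ⟨i, fun l hl => (hi l hl).trans (hj l hl), hi2.trans hj2⟩
  · exact ⟨j, fun l hl => (hi l (hl.trans h)).trans (hj l hl), by rw [hi j h]; exact hj2⟩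

lemma exists_lexMax {n : ℕ} (A : Finset (Fin n → ℕ)) (hA : A.Nonempty) : ∃ G ∈ A, ∀ m ∈ A, LexLE m G := by
  induction hA using Finset.Nonempty.cons_induction with
  | singleton a => exact ⟨a, by simp, fun m hm => Or.inl (by simpa using hm)⟩
  | cons a s ha hs ih =>
    obtain ⟨G, hG, hmax⟩ := ih
    rcases lex_total a G with h | h
    · refine ⟨G, by simp [hG], ?_⟩
      intro m hm
      rcases Finset.mem_cons.1 hm with rfl | hm
      · exact h
      · exact hmax m hm
    · refine ⟨a, by simp, ?_⟩
      intro m hm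
      rcases Finset.mem_cons.1 hm with rfl | hm
      · exact Or.inl rfl
      · rcases hmax m hm with rfl | h3
        · exact Or.inr h
        · exact Or.inr (lexLT_trans h3 h)

end Sheats

theorem greedy_max_weight_and_degree
    (p f : ℕ) (hp : p.Prime) (hf : 0 < f)
    (Fq : Type) [Field Fq] [Fintype Fq] (hcard : Fintype.card Fq = p ^ f)
    (d k : ℕ) (hk : 0 < k) :
    (powerSum Fq d k ≠ 0 ↔ (Uset p (p ^ f) d k).Nonempty) ∧
    ∀ G ∈ Uset p (p ^ f) d k, (∀ m ∈ Uset p (p ^ f) d k, LexLE m G) →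
      (∀ m ∈ Uset p (p ^ f) d k, m ≠ G → wtU m < wtU G) ∧
      (powerSum Fq d k).natDegree = wtU G := by
  classical
  haveI : NeZero f := ⟨hf.ne'⟩
  obtain ⟨c, hc0, hc⟩ := Sheats.powerSum_eq hp Fq hcard d k
  have main : ∀ G ∈ Uset p (p ^ f) d k, (∀ m ∈ Uset p (p ^ f) d k, LexLE m G) →
      (∀ m ∈ Uset p (p ^ f) d k, m ≠ G → wtU m < wtU G) ∧
      (powerSum Fq d k).natDegree = wtU G ∧ powerSum Fq d k ≠ 0 := by
    intro G hG hmax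
    have hwt := Sheats.greedyU f hp.two_le d k G hG hmax
    have hco : (powerSum Fq d k).coeff (wtU G) = c G := by
      rw [hc, Polynomial.finset_sum_coeff, Finset.sum_eq_single G]
      · simp
      · intro m hm hne
        have := hwt m ((Sheats.mem_UF m).1 hm) hne
        rw [Polynomial.coeff_C_mul_X_pow, if_neg (by omega)]
      · intro h; exact absurd ((Sheats.mem_UF G).2 hG) h
    have hcG := hc0 G ((Sheats.mem_UF G).2 hG)
    refine ⟨hwt, ?_, ?_⟩
    · apply le_antisymm
      · rw [hc]
        apply Polynomial.natDegree_sum_le_of_forall_le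
        intro m hm
        refine (Polynomial.natDegree_C_mul_X_pow_le _ _).trans ?_
        by_cases h : m = G
        · rw [h]
        · exact (hwt m ((Sheats.mem_UF m).1 hm) h).le
      · exact Polynomial.le_natDegree_of_ne_zero (by rw [hco]; exact hcG)
    · intro h
      rw [h] at hco
      exact hcG (by simpa using hco.symm)
  refine ⟨⟨?_, ?_⟩, fun G hG hmax => ⟨(main G hG hmax).1, (main G hG hmax).2.1⟩⟩
  · intro h
    by_contra hcon
    apply h
    rw [hc]
    apply Finset.sum_eq_zero
    intro m hm
    exact absurd ⟨m, (Sheats.mem_UF m).1 hm⟩ hcon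
  · rintro ⟨m, hm⟩
    obtain ⟨G, hG, hmax⟩ := Sheats.exists_lexMax (Sheats.UF p (p^f) d k) ⟨m, (Sheats.mem_UF m).2 hm⟩
    exact (main G ((Sheats.mem_UF G).1 hG) (fun m hm => hmax m ((Sheats.mem_UF m).2 hm))).2.2
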